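/- arXiv:2509.06619 — 7 statements merged into one kernel-verified Lean document; each statement's English description precedes it below -/
import Mathlib

section
/- Competitive ratio decomposition: Fix 0 < μ, β > 0, s > 0 and a strictly convex differentiable dispersion function φ : [0,β] → ℝ≥0, and assume μ ≤ τ₂ < β so that the ambiguity set 𝒫(μ,s,β,φ) is nonempty and nondegenerate. Then for every price p ∈ (0,β], the tight lower bound for the competitive ratio satisfies inf_{P ∈ 𝒫} CR(p,P) = min{ (inf_{P ∈ 𝒫} P(X ≥ p)) / (sup_{P ∈ 𝒫} P(X ≥ p)), p / (sup_{P ∈ 𝒫, P(X≥p)>0} E_P(X | X ≥ p)) }. -/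
open MeasureTheory Set

/-- Tail probability `P(X ≥ p) = P([p,∞))` as a real number. -/
noncomputable def tail (P : Measure ℝ) (p : ℝ) : ℝ := (P (Ici p)).toReal

/-- Revenue `REV(p,P) = p · P(X ≥ p)`. -/
noncomputable def REV (p : ℝ) (P : Measure ℝ) : ℝ := p * tail P p

/-- Optimal revenue `OPT(P) = sup_{t>0} t · P(X ≥ t)`. -/
noncomputable def OPT (P : Measure ℝ) : ℝ := ⨆ t : Ioi (0:ℝ), (t : ℝ) * tail P (t : ℝ)

/-- Competitive ratio `CR(p,P) = REV(p,P)/OPT(P)`. -/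
noncomputable def CR (p : ℝ) (P : Measure ℝ) : ℝ := REV p P / OPT P

/-- Conditional expectation `E_P(X | X ≥ p)`. -/
noncomputable def condMean (P : Measure ℝ) (p : ℝ) : ℝ := (∫ x in Ici p, x ∂P) / tail P p

/-- The ambiguity set `𝒫(μ,s,β,φ)`: Borel probability measures on `ℝ` supported in `[0,β]`,
with mean `μ` and dispersion `∫ φ dP = s`. -/
def amb (μ s β : ℝ) (φ : ℝ → ℝ) : Set (Measure ℝ) :=
  {P | IsProbabilityMeasure P ∧ P (Icc 0 β) = 1 ∧ (∫ x, x ∂P) = μ ∧ (∫ x, φ x ∂P) = s}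


lemma integ {β : ℝ} {P : Measure ℝ} (hP : IsProbabilityMeasure P) (h1 : P (Icc 0 β) = 1)
    {f : ℝ → ℝ} (hf : ContinuousOn f (Icc 0 β)) : Integrable f P := by
  have h : P.restrict (Icc 0 β) = P := by
    rw [Measure.restrict_eq_self_of_ae_mem]
    have := (prob_compl_eq_zero_iff (μ := P) (measurableSet_Icc (a := (0:ℝ)) (b := β))).2 h1
    exact this
  rw [← h]
  exact hf.integrableOn_compact isCompact_Icc

lemma ae_mem {β : ℝ} {P : Measure ℝ} (hP : IsProbabilityMeasure P) (h1 : P (Icc 0 β) = 1) :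
    ∀ᵐ x ∂P, x ∈ Icc 0 β := by
  have := (prob_compl_eq_zero_iff (μ := P) (measurableSet_Icc (a := (0:ℝ)) (b := β))).2 h1
  exact this

lemma amb_shift (μ s β : ℝ) (φ : ℝ → ℝ) (hc : ContinuousOn φ (Icc 0 β)) (a k : ℝ) :
    amb μ s β φ = amb μ (s - a - k * μ) β (fun x => φ x - a - k * x) := by
  ext P
  unfold amb
  simp only [mem_ofPred_eq]
  refine and_congr_right fun hP => and_congr_right fun h1 => and_congr_right fun h2 => ?_
  have i1 : Integrable φ P := integ hP h1 hc
  have i2 : Integrable (fun x : ℝ => x) P := integ hP h1 continuousOn_id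
  have : ∫ x, (φ x - a - k * x) ∂P = (∫ x, φ x ∂P) - a - k * μ := by
    have i3 : Integrable (fun x => φ x - a) P := i1.sub (integrable_const a)
    rw [integral_sub i3 (i2.const_mul k), integral_sub i1 (integrable_const a),
      integral_const_mul, h2]
    simp
  rw [this]
  constructor
  · intro h; rw [h]
  · intro h; linarith

noncomputable def Q3 (w0 w1 w2 x0 x1 x2 : ℝ) : Measure ℝ :=
  ENNReal.ofReal w0 • Measure.dirac x0 + ENNReal.ofReal w1 • Measure.dirac x1
    + ENNReal.ofReal w2 • Measure.dirac x2

lemma Q3_meas {w0 w1 w2 x0 x1 x2 : ℝ} (h0 : 0 ≤ w0) (h1 : 0 ≤ w1) (h2 : 0 ≤ w2) {S : Set ℝ}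
    (hS : MeasurableSet S) : Q3 w0 w1 w2 x0 x1 x2 S = ENNReal.ofReal
      (w0 * S.indicator 1 x0 + w1 * S.indicator 1 x1 + w2 * S.indicator 1 x2) := by
  have i : ∀ x, 0 ≤ S.indicator (1 : ℝ → ℝ) x := fun x => indicator_nonneg (by simp) x
  have e : ∀ x, ENNReal.ofReal (S.indicator (1 : ℝ → ℝ) x) = S.indicator 1 x := by
    intro x; by_cases h : x ∈ S <;> simp [h]
  rw [ENNReal.ofReal_add, ENNReal.ofReal_add, ENNReal.ofReal_mul h0, ENNReal.ofReal_mul h1,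
    ENNReal.ofReal_mul h2, e, e, e]
  · simp [Q3, hS]
  all_goals have := mul_nonneg h0 (i x0); have := mul_nonneg h1 (i x1)
  all_goals have := mul_nonneg h2 (i x2); first | assumption | positivity

lemma Q3_int {w0 w1 w2 x0 x1 x2 : ℝ} (h0 : 0 ≤ w0) (h1 : 0 ≤ w1) (h2 : 0 ≤ w2) (f : ℝ → ℝ) :
    ∫ x, f x ∂(Q3 w0 w1 w2 x0 x1 x2) = w0 * f x0 + w1 * f x1 + w2 * f x2 := by
  have i : ∀ w x : ℝ, Integrable f (ENNReal.ofReal w • Measure.dirac x) := fun w x =>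
    (integrable_dirac (by simp)).smul_measure (by simp)
  unfold Q3
  rw [integral_add_measure ((i _ _).add_measure (i _ _)) (i _ _), integral_add_measure (i _ _) (i _ _)]
  simp [integral_smul_measure, h0, h1, h2]

lemma Q3_tail {w0 w1 w2 x0 x1 x2 : ℝ} (h0 : 0 ≤ w0) (h1 : 0 ≤ w1) (h2 : 0 ≤ w2) (t : ℝ) :
    tail (Q3 w0 w1 w2 x0 x1 x2) t = w0 * (if t ≤ x0 then 1 else 0) + w1 * (if t ≤ x1 then 1 else 0)
      + w2 * (if t ≤ x2 then 1 else 0) := by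
  unfold tail
  rw [Q3_meas h0 h1 h2 measurableSet_Ici, ENNReal.toReal_ofReal]
  · simp [indicator_apply]
  · have i : ∀ x, 0 ≤ (Ici t).indicator (1 : ℝ → ℝ) x := fun x => indicator_nonneg (by simp) x
    have := mul_nonneg h0 (i x0)
    have := mul_nonneg h1 (i x1)
    have := mul_nonneg h2 (i x2)
    linarith

lemma Q3_mem {w0 w1 w2 x0 x1 x2 μ s β : ℝ} {φ : ℝ → ℝ} (h0 : 0 ≤ w0) (h1 : 0 ≤ w1) (h2 : 0 ≤ w2)
    (hx0 : x0 ∈ Icc 0 β) (hx1 : x1 ∈ Icc 0 β) (hx2 : x2 ∈ Icc 0 β)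
    (hw : w0 + w1 + w2 = 1) (hm : w0 * x0 + w1 * x1 + w2 * x2 = μ)
    (hd : w0 * φ x0 + w1 * φ x1 + w2 * φ x2 = s) : Q3 w0 w1 w2 x0 x1 x2 ∈ amb μ s β φ := by
  refine ⟨⟨?_⟩, ?_, ?_, ?_⟩
  · rw [Q3_meas h0 h1 h2 MeasurableSet.univ]; simp [hw]
  · rw [Q3_meas h0 h1 h2 measurableSet_Icc]
    simp only [indicator_of_mem hx0, indicator_of_mem hx1, indicator_of_mem hx2]; simp [hw]
  · rw [Q3_int h0 h1 h2, hm]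
  · rw [Q3_int h0 h1 h2, hd]

lemma tail_int {P : Measure ℝ} (_hP : IsProbabilityMeasure P) (t a : ℝ) :
    ∫ x, (Ici t).indicator (fun _ => a) x ∂P = a * tail P t := by
  rw [integral_indicator measurableSet_Ici]
  simp [tail, Measure.real, mul_comm]

lemma dual_up {P : Measure ℝ} {μ s β t u a δ c : ℝ} {ψ : ℝ → ℝ} (hc : ContinuousOn ψ (Icc 0 β))
    (hP : P ∈ amb μ s β ψ)
    (h : ∀ x ∈ Icc 0 β, (if t ≤ x then u else 0) ≤ a * x + δ * ψ x + c) :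
    u * tail P t ≤ a * μ + δ * s + c := by
  obtain ⟨hP, h1, h2, h3⟩ := hP
  have i1 : Integrable ψ P := integ hP h1 hc
  have i2 : Integrable (fun x : ℝ => x) P := integ hP h1 continuousOn_id
  have e : ∫ x, (a * x + δ * ψ x + c) ∂P = a * μ + δ * s + c := by
    have i3 : Integrable (fun x => a * x + δ * ψ x) P := (i2.const_mul a).add (i1.const_mul δ)
    rw [integral_add i3 (integrable_const c),
      integral_add (i2.const_mul a) (i1.const_mul δ), integral_const_mul, integral_const_mul, h2, h3]
    simp
  rw [← tail_int hP, ← e]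
  refine integral_mono_ae ((integrable_const u).indicator measurableSet_Ici)
    (((i2.const_mul a).add (i1.const_mul δ)).add (integrable_const c)) ?_
  filter_upwards [ae_mem hP h1] with x hx
  simpa [indicator_apply] using h x hx

lemma tail_nonneg (P : Measure ℝ) (t : ℝ) : 0 ≤ tail P t := ENNReal.toReal_nonneg

lemma tail_le_one {P : Measure ℝ} {μ s β : ℝ} {ψ : ℝ → ℝ} (hP : P ∈ amb μ s β ψ) (t : ℝ) :
    tail P t ≤ 1 := by
  have := hP.1
  exact ENNReal.toReal_le_of_le_ofReal zero_le_one (by simpa using prob_le_one)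

lemma tail_anti {P : Measure ℝ} {μ s β : ℝ} {ψ : ℝ → ℝ} (hP : P ∈ amb μ s β ψ) {t u : ℝ}
    (h : t ≤ u) : tail P u ≤ tail P t := by
  have := hP.1
  exact ENNReal.toReal_mono (measure_ne_top _ _) (measure_mono (Ici_subset_Ici.2 h))

lemma le_OPT {P : Measure ℝ} {μ s β : ℝ} {ψ : ℝ → ℝ} (hc : ContinuousOn ψ (Icc 0 β))
    (hP : P ∈ amb μ s β ψ) {t : ℝ} (ht : 0 < t) : t * tail P t ≤ OPT P := by
  refine le_ciSup (f := fun t : Ioi (0:ℝ) => (t : ℝ) * tail P t) ⟨μ, ?_⟩ ⟨t, ht⟩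
  rintro _ ⟨u, rfl⟩
  have := dual_up (t := u) (u := u) (a := 1) (δ := 0) (c := 0) hc hP (by
    intro x hx
    split_ifs with h
    · simpa using h
    · simpa using hx.1)
  simpa using this

lemma OPT_pos {P : Measure ℝ} {μ s β : ℝ} {ψ : ℝ → ℝ} (hμ : 0 < μ) (hβ : 0 < β)
    (hc : ContinuousOn ψ (Icc 0 β)) (hP : P ∈ amb μ s β ψ) : 0 < OPT P := by
  have := dual_up (t := μ/2) (u := -β) (a := -1) (δ := 0) (c := μ/2) hc hP (by
    intro x hx
    split_ifs with h
    · linarith [hx.2]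
    · push Not at h; linarith)
  have h2 := le_OPT hc hP (half_pos hμ)
  have : 0 < tail P (μ/2) := by
    by_contra hh
    push Not at hh
    nlinarith [tail_nonneg P (μ/2)]
  nlinarith [mul_pos (half_pos hμ) this]

lemma CR_nonneg {P : Measure ℝ} {μ s β : ℝ} {ψ : ℝ → ℝ} (hμ : 0 < μ) (hβ : 0 < β)
    (hc : ContinuousOn ψ (Icc 0 β)) (hP : P ∈ amb μ s β ψ) {p : ℝ} (hp : 0 < p) : 0 ≤ CR p P :=
  div_nonneg (mul_nonneg hp.le (tail_nonneg _ _)) (OPT_pos hμ hβ hc hP).le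

lemma condMean_bounds {P : Measure ℝ} {μ s β : ℝ} {ψ : ℝ → ℝ}
    (hP : P ∈ amb μ s β ψ) {p : ℝ} (hq : 0 < tail P p) :
    p ≤ condMean P p ∧ condMean P p ≤ β ∧ ∀ t, p ≤ t → 0 ≤ t → t * tail P t ≤ condMean P p * tail P p := by
  obtain ⟨hP, h1, h2, h3⟩ := hP
  have i2 : Integrable (fun x : ℝ => x) P := integ hP h1 continuousOn_id
  have e : ∫ x in Ici p, x ∂P = ∫ x, (Ici p).indicator (fun x => x) x ∂P :=
    (integral_indicator measurableSet_Ici).symm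
  have i3 := i2.indicator (measurableSet_Ici (a := p))
  have i4 : ∀ a t : ℝ, Integrable ((Ici t).indicator (fun _ => a)) P :=
    fun a t => (integrable_const a).indicator measurableSet_Ici
  unfold condMean
  refine ⟨?_, ?_, ?_⟩
  · rw [le_div_iff₀ hq, ← tail_int hP, e]
    refine integral_mono (i4 _ _) i3 fun x => ?_
    by_cases h : p ≤ x <;> simp [indicator_apply, h]
  · rw [div_le_iff₀ hq, ← tail_int hP, e]
    refine integral_mono_ae i3 (i4 _ _) ?_
    filter_upwards [ae_mem hP h1] with x hx
    by_cases h : p ≤ x <;> simp [indicator_apply, h, hx.2]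
  · intro t ht ht0
    rw [div_mul_cancel₀ _ hq.ne', ← tail_int hP, e]
    refine integral_mono_ae (i4 _ _) i3 ?_
    filter_upwards [ae_mem hP h1] with x hx
    by_cases h : t ≤ x
    · have : p ≤ x := ht.trans h
      simp [indicator_apply, h, this]
    · by_cases h' : p ≤ x <;> simp [indicator_apply, h, h', hx.1]

lemma chord {β : ℝ} {ψ : ℝ → ℝ} (h : StrictConvexOn ℝ (Icc 0 β) ψ) {m x c : ℝ} (hm : 0 ≤ m)
    (hmx : m < x) (hxc : x < c) (hc : c ≤ β) : ψ x * (c - m) < ψ m * (c - x) + ψ c * (x - m) := by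
  have := h.slope_strict_mono_adjacent (x := m) (y := x) (z := c) ⟨hm, by linarith⟩ ⟨by linarith, hc⟩ hmx hxc
  rw [div_lt_div_iff₀ (by linarith) (by linarith)] at this
  nlinarith

/-- Collapse of both halves to their means. -/
lemma collapse {P : Measure ℝ} {μ s β : ℝ} {ψ : ℝ → ℝ} (hcv : ConvexOn ℝ (Icc 0 β) ψ)
    (hc : ContinuousOn ψ (Icc 0 β)) (hP : P ∈ amb μ s β ψ) {p : ℝ} (hpμ : p ≤ μ)
    (hq1 : tail P p < 1) : 0 < tail P p ∧ ∃ m, 0 ≤ m ∧ m < p ∧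
      (1 - tail P p) * m + tail P p * condMean P p = μ ∧
      (1 - tail P p) * ψ m + tail P p * ψ (condMean P p) ≤ s := by
  have hPP := hP
  obtain ⟨hP, h1, h2, h3⟩ := hP
  have i1 : Integrable ψ P := integ hP h1 hc
  have i2 : Integrable (fun x : ℝ => x) P := integ hP h1 continuousOn_id
  have hIio : (P (Iio p)).toReal = 1 - tail P p := by
    have := probReal_compl_eq_one_sub (μ := P) (measurableSet_Ici (a := p))
    rw [compl_Ici] at this
    exact this
  have sp2 := integral_add_compl (measurableSet_Ici (a := p)) i2
  have sp1 := integral_add_compl (measurableSet_Ici (a := p)) i1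
  rw [compl_Ici] at sp1 sp2
  set q := tail P p with hqdef
  have hl : 0 < 1 - q := by linarith
  have hne : P (Iio p) ≠ 0 := by
    intro h; rw [h] at hIio; simp at hIio; linarith
  set m := (∫ x in Iio p, x ∂P) / (1 - q) with hm
  have hmI : (1 - q) * m = ∫ x in Iio p, x ∂P := by rw [hm]; field_simp
  have hmp : m < p := by
    rw [hm, div_lt_iff₀ hl]
    have : 0 < ∫ x in Iio p, (p - x) ∂P := by
      rw [setIntegral_pos_iff_support_of_nonneg_ae]
      · have : (Function.support fun x : ℝ => p - x) ∩ Iio p = Iio p := by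
          ext x; simp only [Function.mem_support, mem_inter_iff, mem_Iio]
          constructor
          · exact fun h => h.2
          · exact fun h => ⟨by linarith, h⟩
        rw [this]; exact pos_iff_ne_zero.2 hne
      · filter_upwards [ae_restrict_mem measurableSet_Iio] with x hx
        simp only [mem_Iio] at hx
        simp; linarith
      · exact ((integrable_const p).sub i2).integrableOn
    rw [integral_sub (integrable_const p).integrableOn i2.integrableOn] at this
    simp [Measure.real, hIio] at this
    linarith
  have hm0 : 0 ≤ m := by
    refine div_nonneg (integral_nonneg_of_ae (ae_restrict_of_ae ?_)) hl.le
    filter_upwards [ae_mem hP h1] with x hx using hx.1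
  have hq : 0 < q := by
    rcases (tail_nonneg P p).lt_or_eq with h | h
    · exact h
    · exfalso
      have h0 : q = 0 := h.symm
      have hz : P (Ici p) = 0 := by
        have : (P (Ici p)).toReal = 0 := h0
        rcases (ENNReal.toReal_eq_zero_iff _).1 this with h | h
        · exact h
        · exact absurd h (measure_ne_top _ _)
      rw [Measure.restrict_eq_zero.2 hz] at sp2
      simp [h2] at sp2
      rw [h0] at hmI
      linarith
  have hcI : q * condMean P p = ∫ x in Ici p, x ∂P := by
    unfold condMean; rw [← hqdef]; field_simp
  have hneI : P (Ici p) ≠ 0 := by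
    intro h; rw [hqdef, tail, h] at hq; simp at hq
  refine ⟨hq, m, hm0, hmp, by rw [hmI, hcI]; linarith, ?_⟩
  have J1 := hcv.map_set_average_le hc isClosed_Icc hne (measure_ne_top _ _)
    (ae_restrict_of_ae (ae_mem hP h1)) i2.integrableOn i1.integrableOn
  have J2 := hcv.map_set_average_le hc isClosed_Icc hneI (measure_ne_top _ _)
    (ae_restrict_of_ae (ae_mem hP h1)) i2.integrableOn i1.integrableOn
  rw [setAverage_eq, setAverage_eq] at J1 J2
  simp only [Measure.real, hIio, smul_eq_mul] at J1 J2
  have hq' : (P (Ici p)).toReal = q := rfl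
  rw [hq', ← hcI, inv_mul_cancel_left₀ hq.ne'] at J2
  rw [← hmI, inv_mul_cancel_left₀ hl.ne'] at J1
  rw [inv_mul_eq_div, le_div_iff₀ hq] at J2
  rw [inv_mul_eq_div, le_div_iff₀ hl] at J1
  linarith

lemma bddB (μ s β : ℝ) (ψ : ℝ → ℝ) (p : ℝ) : BddBelow ((fun P => tail P p) '' amb μ s β ψ) :=
  ⟨0, by rintro _ ⟨P, _, rfl⟩; exact tail_nonneg P p⟩

lemma bddA (μ s β : ℝ) (ψ : ℝ → ℝ) (p : ℝ) : BddAbove ((fun P => tail P p) '' amb μ s β ψ) :=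
  ⟨1, by rintro _ ⟨P, hP, rfl⟩; exact tail_le_one hP p⟩

lemma bddC (μ s β : ℝ) (ψ : ℝ → ℝ) (p : ℝ) :
    BddAbove ((fun P => condMean P p) '' {P ∈ amb μ s β ψ | 0 < tail P p}) :=
  ⟨β, by rintro _ ⟨P, hP, rfl⟩; exact (condMean_bounds hP.1 hP.2).2.1⟩

lemma lower {P : Measure ℝ} {μ s β p : ℝ} {ψ : ℝ → ℝ} (hμ : 0 < μ) (hβ : 0 < β)
    (hc : ContinuousOn ψ (Icc 0 β)) (hP : P ∈ amb μ s β ψ) (hp : 0 < p)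
    (hS : ∀ t, 0 < t → t < p →
      t * tail P t ≤ p * sSup ((fun P => tail P p) '' amb μ s β ψ)) :
    min (sInf ((fun P => tail P p) '' amb μ s β ψ) /
              sSup ((fun P => tail P p) '' amb μ s β ψ))
            (p / sSup ((fun P => condMean P p) '' {P ∈ amb μ s β ψ | 0 < tail P p})) ≤ CR p P := by
  have hI : sInf ((fun P => tail P p) '' amb μ s β ψ) ≤ tail P p :=
    csInf_le (bddB μ s β ψ p) ⟨P, hP, rfl⟩
  have hI0 : 0 ≤ sInf ((fun P => tail P p) '' amb μ s β ψ) :=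
    Real.sInf_nonneg (by rintro _ ⟨P, _, rfl⟩; exact tail_nonneg P p)
  have hS0 : 0 ≤ sSup ((fun P => tail P p) '' amb μ s β ψ) :=
    Real.sSup_nonneg (by rintro _ ⟨P, _, rfl⟩; exact tail_nonneg P p)
  have hC0 : 0 ≤ sSup ((fun P => condMean P p) '' {P ∈ amb μ s β ψ | 0 < tail P p}) :=
    Real.sSup_nonneg (by
      rintro _ ⟨P, hP, rfl⟩; exact hp.le.trans (condMean_bounds hP.1 hP.2).1)
  have hC : 0 < tail P p → condMean P p ≤
      sSup ((fun P => condMean P p) '' {P ∈ amb μ s β ψ | 0 < tail P p}) :=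
    fun h => le_csSup (bddC μ s β ψ p) ⟨P, ⟨hP, h⟩, rfl⟩
  generalize sInf ((fun P => tail P p) '' amb μ s β ψ) = I at *
  generalize sSup ((fun P => tail P p) '' amb μ s β ψ) = S at *
  generalize sSup ((fun P => condMean P p) '' {P ∈ amb μ s β ψ | 0 < tail P p}) = C at *
  by_cases hM : min (I / S) (p / C) ≤ 0
  · exact hM.trans (CR_nonneg hμ hβ hc hP hp)
  push Not at hM
  set M := min (I / S) (p / C) with hMd
  have hM1 : M ≤ I / S := min_le_left _ _
  have hM2 : M ≤ p / C := min_le_right _ _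
  have hSp : 0 < S := by
    rcases hS0.lt_or_eq with h | h
    · exact h
    · rw [← h] at hM1; simp at hM1; linarith
  have hCp : 0 < C := by
    rcases hC0.lt_or_eq with h | h
    · exact h
    · rw [← h] at hM2; simp at hM2; linarith
  rw [le_div_iff₀ hSp] at hM1
  rw [le_div_iff₀ hCp] at hM2
  unfold CR REV
  rw [le_div_iff₀ (OPT_pos hμ hβ hc hP), mul_comm, ← le_div_iff₀ hM]
  haveI : Nonempty (Ioi (0:ℝ)) := ⟨⟨1, by simp⟩⟩
  refine ciSup_le ?_
  rintro ⟨t, ht⟩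
  have ht : 0 < t := ht
  simp only
  rw [le_div_iff₀ hM]
  rcases lt_or_ge t p with htp | htp
  · have h1 := mul_le_mul_of_nonneg_right (hS t ht htp) hM.le
    have h2 := mul_le_mul_of_nonneg_left hM1 hp.le
    have h3 := mul_le_mul_of_nonneg_left hI hp.le
    nlinarith
  · rcases (tail_nonneg P p).lt_or_eq with h | h
    · have h1 := (condMean_bounds hP h).2.2 t htp ht.le
      have h2 := mul_le_mul_of_nonneg_right h1 hM.le
      have h3 := mul_le_mul_of_nonneg_right (hC h) (mul_pos h hM).le
      have h4 := mul_le_mul_of_nonneg_right hM2 h.le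
      nlinarith
    · have h1 := tail_anti hP htp
      have h2 := tail_nonneg P t
      have : tail P t = 0 := by linarith
      rw [this, ← h]; simp

lemma CR_le {P : Measure ℝ} {μ s β p t : ℝ} {ψ : ℝ → ℝ}
    (hc : ContinuousOn ψ (Icc 0 β)) (hP : P ∈ amb μ s β ψ) (hp : 0 < p) (ht : 0 < t) (hμ : 0 < μ) (hβ : 0 < β) :
    CR p P * (t * tail P t) ≤ p * tail P p := by
  have h := le_OPT hc hP ht
  have h0 := OPT_pos hμ hβ hc hP
  have : CR p P * OPT P = p * tail P p := by unfold CR REV; field_simp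
  rw [← this]
  exact mul_le_mul_of_nonneg_left h (CR_nonneg hμ hβ hc hP hp)

open Filter Topology in
lemma lim_le {f g : ℝ → ℝ} {l p : ℝ} (hf : ContinuousAt f p) (hg : ContinuousAt g p) (hlp : l < p)
    (h : ∀ r, l < r → r < p → f r ≤ g r) : f p ≤ g p := by
  refine le_of_tendsto_of_tendsto (b := 𝓝[<] p) (hf.tendsto.mono_left nhdsWithin_le_nhds)
    (hg.tendsto.mono_left nhdsWithin_le_nhds) ?_
  filter_upwards [Ioo_mem_nhdsLT hlp] with r hr using h r hr.1 hr.2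

/-- existence of two-point distributions -/
lemma twopt {μ s β r : ℝ} {ψ : ℝ → ℝ} (hμβ : μ < β)
    (hc : ContinuousOn ψ (Icc 0 β)) (hr : 0 ≤ r) (hrμ : r < μ)
    (hβ0 : ψ β = 0) (hs : ψ μ ≤ s) (h : s * (β - r) ≤ ψ r * (β - μ)) :
    ∃ y v, μ ≤ y ∧ y ≤ β ∧ 0 < v ∧ v ≤ 1 ∧ v * (y - r) = μ - r ∧ (1 - v) * ψ r + v * ψ y = s ∧
      Q3 0 (1 - v) v 0 r y ∈ amb μ s β ψ := by
  have hcc : ContinuousOn (fun y => ψ r * (y - μ) + ψ y * (μ - r) - s * (y - r)) (Icc μ β) := by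
    have : ContinuousOn ψ (Icc μ β) := hc.mono (Icc_subset_Icc (by linarith) le_rfl)
    fun_prop
  have := intermediate_value_Icc hμβ.le hcc
  obtain ⟨y, hy, hy0⟩ := this (show (0:ℝ) ∈ _ from ⟨by nlinarith, by simp only [hβ0]; linarith⟩)
  simp only at hy0
  have hyr : 0 < y - r := by linarith [hy.1]
  have hv : (μ - r) / (y - r) * (y - r) = μ - r := by field_simp
  set v := (μ - r) / (y - r) with hvd
  have hv0 : 0 < v := div_pos (by linarith) hyr
  have hv1 : v ≤ 1 := by rw [hvd, div_le_one hyr]; linarith [hy.1]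
  have hd : (1 - v) * ψ r + v * ψ y = s := by
    have : ((1 - v) * ψ r + v * ψ y - s) * (y - r) = 0 := by
      have : ((1 - v) * ψ r + v * ψ y - s) * (y - r)
        = ψ r * ((y - r) - v * (y - r)) + ψ y * (v * (y - r)) - s * (y - r) := by ring
      rw [this, hv]; linarith
    rcases mul_eq_zero.1 this with h | h <;> linarith
  refine ⟨y, v, hy.1, hy.2, hv0, hv1, hv, hd, Q3_mem le_rfl (by linarith) hv0.le
    ⟨le_rfl, by linarith⟩ ⟨hr, by linarith⟩ ⟨by linarith, hy.2⟩ (by ring) (by linarith) ?_⟩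
  linarith

/-- comparison of an arbitrary distribution with a two-point one -/
lemma compare2 {P : Measure ℝ} {μ s β r p m y v : ℝ} {ψ : ℝ → ℝ}
    (hcv : StrictConvexOn ℝ (Icc 0 β) ψ) (hP : P ∈ amb μ s β ψ) (hm0 : 0 ≤ m) (hmr : m < r)
    (hq : 0 < tail P p) (hrp : r < p) (hpμ : p ≤ μ) (hμy : μ ≤ y)
    (h1 : (1 - tail P p) * m + tail P p * condMean P p = μ)
    (h2 : (1 - tail P p) * ψ m + tail P p * ψ (condMean P p) ≤ s)
    (hv0 : 0 < v) (hv1 : v ≤ 1) (hv : v * (y - r) = μ - r) (hd : (1 - v) * ψ r + v * ψ y = s) :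
    condMean P p ≤ y ∧ v ≤ tail P p := by
  obtain ⟨-, hcβ, -⟩ := condMean_bounds hP hq
  set q := tail P p
  set c := condMean P p
  have hcy : c ≤ y := by
    by_contra hh
    push Not at hh
    have c1 := chord hcv hm0 hmr (by linarith : r < c) hcβ
    have c2 := chord hcv hm0 (by linarith : m < y) hh hcβ
    have e1 := mul_le_mul_of_nonneg_left c1.le (by linarith : 0 ≤ 1 - v)
    have e2 := mul_lt_mul_of_pos_left c2 hv0
    have e3 : ((1 - v) * ψ r + v * ψ y) * (c - m) < ψ m * (c - μ) + ψ c * (μ - m) := by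
      have hμ' : μ = r + v * (y - r) := by linarith
      rw [hμ']; nlinarith
    have e4 : ((1 - q) * ψ m + q * ψ c) * (c - m) = ψ m * (c - μ) + ψ c * (μ - m) := by
      rw [← h1]; ring
    rw [hd, ← e4] at e3
    nlinarith
  refine ⟨hcy, ?_⟩
  have hqy : μ - m ≤ q * (y - m) := by nlinarith
  -- v (y - r) = μ - r
  have : v * (y - m) ≤ μ - m := by nlinarith
  have h3 : v * (y - m) ≤ q * (y - m) := by linarith
  exact le_of_mul_le_mul_right h3 (by linarith)

lemma X_le {P : Measure ℝ} {μ s β p : ℝ} {ψ : ℝ → ℝ} (hμ : 0 < μ) (hβ : 0 < β)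
    (hc : ContinuousOn ψ (Icc 0 β)) (hp : 0 < p) (hP : P ∈ amb μ s β ψ) :
    sInf ((fun P => CR p P) '' amb μ s β ψ) ≤ CR p P :=
  csInf_le ⟨0, by rintro _ ⟨P, hP, rfl⟩; exact CR_nonneg hμ hβ hc hP hp⟩ ⟨P, hP, rfl⟩

lemma X_nonneg {μ s β p : ℝ} {ψ : ℝ → ℝ} (hμ : 0 < μ) (hβ : 0 < β)
    (hc : ContinuousOn ψ (Icc 0 β)) (hp : 0 < p) :
    0 ≤ sInf ((fun P => CR p P) '' amb μ s β ψ) :=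
  Real.sInf_nonneg (by rintro _ ⟨P, hP, rfl⟩; exact CR_nonneg hμ hβ hc hP hp)

lemma X_mul_le {P : Measure ℝ} {μ s β p t : ℝ} {ψ : ℝ → ℝ} (hμ : 0 < μ) (hβ : 0 < β)
    (hc : ContinuousOn ψ (Icc 0 β)) (hp : 0 < p) (hP : P ∈ amb μ s β ψ) (ht : 0 < t) :
    sInf ((fun P => CR p P) '' amb μ s β ψ) * (t * tail P t) ≤ p * tail P p :=
  (mul_le_mul_of_nonneg_right (X_le hμ hβ hc hp hP) (mul_nonneg ht.le (tail_nonneg _ _))).trans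
    (CR_le hc hP hp ht hμ hβ)

lemma neg_in {β x : ℝ} {ψ : ℝ → ℝ} (hcv : StrictConvexOn ℝ (Icc 0 β) ψ) (h0 : ψ 0 = 0)
    (hβ0 : ψ β = 0) (hx : 0 < x) (hxβ : x < β) : ψ x < 0 := by
  have := chord hcv le_rfl hx hxβ le_rfl
  rw [h0, hβ0] at this
  have hβ : 0 < β := by linarith
  by_contra hh
  push Not at hh
  nlinarith [mul_nonneg hh hβ.le]

lemma slope0 {β x z : ℝ} {ψ : ℝ → ℝ} (hcv : StrictConvexOn ℝ (Icc 0 β) ψ) (h0 : ψ 0 = 0)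
    (hx : 0 < x) (hxz : x < z) (hz : z ≤ β) : ψ x * z < ψ z * x := by
  have := chord hcv le_rfl hx hxz hz
  rw [h0] at this
  linarith

lemma case2 {μ s β τ p : ℝ} {ψ : ℝ → ℝ} (hμ : 0 < μ) (hμτ : μ ≤ τ) (hτβ : τ < β)
    (hcv : StrictConvexOn ℝ (Icc 0 β) ψ) (hc : ContinuousOn ψ (Icc 0 β)) (h0 : ψ 0 = 0)
    (hβ0 : ψ β = 0) (hs : s * τ = μ * ψ τ) (hp : 0 < p) (hpτ : p ≤ τ)
    (hA : Q3 (1 - μ / τ) (μ / τ) 0 0 τ 0 ∈ amb μ s β ψ)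
    (hcase : s * (β - p) ≤ ψ p * (β - μ)) :
    sInf ((fun P => CR p P) '' amb μ s β ψ) =
        min (sInf ((fun P => tail P p) '' amb μ s β ψ) /
              sSup ((fun P => tail P p) '' amb μ s β ψ))
            (p / sSup ((fun P => condMean P p) '' {P ∈ amb μ s β ψ | 0 < tail P p})) := by
  have hτ : 0 < τ := by linarith
  have hβ : 0 < β := by linarith
  have hτn := neg_in hcv h0 hβ0 hτ hτβ
  have hsn : s < 0 := by
    by_contra hh
    push Not at hh
    nlinarith [mul_nonneg hh hτ.le]
  have hψμ : ψ μ ≤ s := by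
    rcases hμτ.lt_or_eq with h | h
    · have := slope0 hcv h0 hμ h hτβ.le
      have : ψ μ * τ ≤ s * τ := by linarith
      exact le_of_mul_le_mul_right this hτ
    · subst h
      exact le_of_mul_le_mul_right (by linarith : ψ μ * μ ≤ s * μ) hμ
  have hpμ : p ≤ μ := by
    by_contra hh
    push Not at hh
    have h1 : ψ p * μ ≤ s * p := by
      have h2 : ψ p * τ ≤ ψ τ * p := by
        rcases hpτ.lt_or_eq with h | h
        · exact (slope0 hcv h0 hp h hτβ.le).le
        · rw [h]
      have : ψ p * μ * τ ≤ s * p * τ := by nlinarith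
      exact le_of_mul_le_mul_right this hτ
    have h3 := mul_le_mul_of_nonneg_right hcase hμ.le
    have h4 := mul_le_mul_of_nonneg_right h1 (by linarith : 0 ≤ β - μ)
    have h5 : 0 ≤ s * (β * (p - μ)) := by nlinarith
    have h6 : 0 < β * (p - μ) := mul_pos hβ (by linarith)
    nlinarith
  have hpμ' : p < μ ∨ p = τ ∧ μ = τ := by
    rcases hpμ.lt_or_eq with h | h
    · exact Or.inl h
    · right
      subst h
      rcases hμτ.lt_or_eq with h | h
      · exfalso
        have h1 := slope0 hcv h0 hμ h hτβ.le
        have h2 : s ≤ ψ p := le_of_mul_le_mul_right hcase (by linarith)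
        nlinarith [mul_le_mul_of_nonneg_right h2 hτ.le]
      · exact ⟨h, h⟩
  have hS1 : 1 ≤ sSup ((fun P => tail P p) '' amb μ s β ψ) := by
    rcases hpμ' with h | ⟨h1, h2⟩
    · obtain ⟨y, v, hy1, hy2, hv0, hv1, -, -, hQ⟩ := twopt (by linarith) hc hp.le h hβ0 hψμ hcase
      refine le_csSup (bddA μ s β ψ p) ⟨_, hQ, ?_⟩
      simp only
      rw [Q3_tail le_rfl (by linarith) hv0.le, if_pos le_rfl, if_pos (by linarith : p ≤ y)]
      ring
    · refine le_csSup (bddA μ s β ψ p) ⟨_, hA, ?_⟩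
      simp only
      have : μ / τ = 1 := by rw [h2]; field_simp
      rw [this, Q3_tail (by norm_num) (by norm_num) le_rfl, if_pos hpτ]
      ring
  have hSle : sSup ((fun P => tail P p) '' amb μ s β ψ) ≤ 1 :=
    csSup_le ⟨_, _, hA, rfl⟩ (by rintro _ ⟨P, hP, rfl⟩; exact tail_le_one hP p)
  have hS : sSup ((fun P => tail P p) '' amb μ s β ψ) = 1 := le_antisymm hSle hS1
  refine le_antisymm ?_ ?_
  · have key : ∀ P ∈ amb μ s β ψ, sInf ((fun P => CR p P) '' amb μ s β ψ) ≤ tail P p ∧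
        (0 < tail P p → sInf ((fun P => CR p P) '' amb μ s β ψ) * condMean P p ≤ p) := by
      intro P hP
      have hX := fun (Q : Measure ℝ) (hQ : Q ∈ amb μ s β ψ) (t : ℝ) (ht : 0 < t) =>
        X_mul_le hμ hβ hc hp hQ ht
      have hX0 := X_nonneg (s := s) hμ hβ hc hp
      generalize sInf ((fun P => CR p P) '' amb μ s β ψ) = X at *
      have hex : ∃ l, 0 ≤ l ∧ l < p ∧ ∀ r, l < r → r < p → ∃ y v, r < y ∧ 0 < v ∧ v ≤ 1 ∧
          p ≤ y ∧ Q3 0 (1 - v) v 0 r y ∈ amb μ s β ψ ∧ v ≤ tail P p ∧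
          (0 < tail P p → condMean P p ≤ y) := by
        have hA2 : ∀ r, 0 < r → r < p → s * (β - r) ≤ ψ r * (β - μ) := by
          intro r hr hrp
          have h1 := chord hcv hr.le hrp (by linarith : p < β) le_rfl
          rw [hβ0] at h1
          have h2 := mul_le_mul_of_nonneg_right hcase (by linarith : 0 ≤ β - r)
          have h3 := mul_le_mul_of_nonneg_right h1.le (by linarith : 0 ≤ β - μ)
          have : s * (β - r) * (β - p) ≤ ψ r * (β - μ) * (β - p) := by nlinarith
          exact le_of_mul_le_mul_right this (by linarith)
        rcases (tail_le_one hP p).lt_or_eq with hq1 | hq1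
        · obtain ⟨hq, m, hm0, hmp, e1, e2⟩ := collapse hcv.convexOn hc hP hpμ hq1
          refine ⟨m, hm0, hmp, fun r hmr hrp => ?_⟩
          obtain ⟨y, v, hy1, hy2, hv0, hv1, hv, hd, hQ⟩ := twopt (by linarith) hc (by linarith : 0 ≤ r)
            (by linarith) hβ0 hψμ (hA2 r (by linarith) hrp)
          obtain ⟨k1, k2⟩ := compare2 hcv hP hm0 hmr hq hrp hpμ hy1 e1 e2 hv0 hv1 hv hd
          exact ⟨y, v, by linarith, hv0, hv1, by linarith, hQ, k2, fun _ => k1⟩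
        · refine ⟨0, le_rfl, hp, fun r hmr hrp => ?_⟩
          obtain ⟨y, v, hy1, hy2, hv0, hv1, hv, hd, hQ⟩ := twopt (by linarith) hc (by linarith : 0 ≤ r)
            (by linarith) hβ0 hψμ (hA2 r (by linarith) hrp)
          refine ⟨y, v, by linarith, hv0, hv1, by linarith, hQ, by rw [hq1]; exact hv1, fun _ => ?_⟩
          refine le_trans ?_ hy1
          unfold condMean
          rw [hq1, div_one]
          have hPP := hP.1
          rw [← hP.2.2.1]
          refine setIntegral_le_integral (integ hP.1 hP.2.1 continuousOn_id) ?_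
          filter_upwards [ae_mem hP.1 hP.2.1] with x hx using hx.1
      obtain ⟨l, hl0, hlp, hex⟩ := hex
      constructor
      · have := lim_le (f := fun r => X * r) (g := fun _ => p * tail P p) (p := p) (by fun_prop)
          (by fun_prop) hlp (by
            intro r hlr hrp
            obtain ⟨y, v, hry, hv0, hv1, hpy, hQ, hvq, -⟩ := hex r hlr hrp
            have h := hX _ hQ r (by linarith)
            rw [Q3_tail le_rfl (by linarith) hv0.le, Q3_tail le_rfl (by linarith) hv0.le,
              if_pos le_rfl, if_pos hry.le, if_neg (not_le.2 hrp), if_pos hpy] at h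
            have := mul_le_mul_of_nonneg_left hvq hp.le
            nlinarith)
        nlinarith
      · intro hq
        obtain ⟨y, v, hry, hv0, hv1, hpy, hQ, -, hcy⟩ := hex ((l + p) / 2) (by linarith) (by linarith)
        have h := hX _ hQ y (by linarith)
        rw [Q3_tail le_rfl (by linarith) hv0.le, Q3_tail le_rfl (by linarith) hv0.le,
              if_pos le_rfl, if_neg (not_le.2 hry), if_neg (by linarith : ¬ p ≤ (l + p) / 2), if_pos hpy] at h
        have h2 : X * y * v ≤ p * v := by
          have e : X * y * v = X * (y * (0 * (if y ≤ 0 then 1 else 0) + (1 - v) * 0 + v * 1)) := by ring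
          rw [e]; refine h.trans (le_of_eq ?_); ring
        have h3 := le_of_mul_le_mul_right h2 hv0
        have := mul_le_mul_of_nonneg_left (hcy hq) hX0
        linarith
    rw [hS, div_one]
    refine le_min ?_ ?_
    · refine le_csInf ⟨_, _, hA, rfl⟩ ?_
      rintro _ ⟨P, hP, rfl⟩
      exact (key P hP).1
    · have hQ : 0 < tail (Q3 (1 - μ / τ) (μ / τ) 0 0 τ 0) p := by
        have : 0 < μ / τ := by positivity
        have h1 : μ / τ ≤ 1 := by rw [div_le_one hτ]; exact hμτ
        rw [Q3_tail (by linarith) this.le le_rfl, if_pos hpτ, if_neg (not_le.2 hp)]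
        simpa using this
      have hCpos : 0 < sSup ((fun P => condMean P p) '' {P ∈ amb μ s β ψ | 0 < tail P p}) :=
        lt_of_lt_of_le (lt_of_lt_of_le hp (condMean_bounds hA hQ).1)
          (le_csSup (bddC μ s β ψ p) ⟨_, ⟨hA, hQ⟩, rfl⟩)
      have hX0 := X_nonneg (s := s) hμ hβ hc hp
      rcases hX0.lt_or_eq with hX | hX
      · rw [le_div_iff₀ hCpos, mul_comm, ← le_div_iff₀ hX]
        refine csSup_le ⟨_, _, ⟨hA, hQ⟩, rfl⟩ ?_
        rintro _ ⟨P, hP, rfl⟩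
        rw [le_div_iff₀ hX, mul_comm]
        exact (key P hP.1).2 hP.2
      · rw [← hX]; positivity
  · refine le_csInf ⟨_, _, hA, rfl⟩ ?_
    rintro _ ⟨P, hP, rfl⟩
    refine lower hμ hβ hc hP hp fun t ht htp => ?_
    rw [hS]
    have := tail_le_one hP t
    have := tail_nonneg P t
    nlinarith

lemma case1 {μ s β τ p : ℝ} {ψ : ℝ → ℝ} (hμ : 0 < μ) (hμτ : μ ≤ τ) (hτβ : τ < β)
    (hcv : StrictConvexOn ℝ (Icc 0 β) ψ) (hc : ContinuousOn ψ (Icc 0 β)) (h0 : ψ 0 = 0)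
    (hβ0 : ψ β = 0) (hs : s * τ = μ * ψ τ) (hp : 0 < p) (hpτ : p ≤ τ)
    (hcase : ψ p * (β - μ) < s * (β - p)) :
    sInf ((fun P => CR p P) '' amb μ s β ψ) =
        min (sInf ((fun P => tail P p) '' amb μ s β ψ) /
              sSup ((fun P => tail P p) '' amb μ s β ψ))
            (p / sSup ((fun P => condMean P p) '' {P ∈ amb μ s β ψ | 0 < tail P p})) := by
  have hτ : 0 < τ := by linarith
  have hβ : 0 < β := by linarith
  have hpβ : p < β := by linarith
  have hτn := neg_in hcv h0 hβ0 hτ hτβ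
  have hpn := neg_in hcv h0 hβ0 hp hpβ
  have hsn : s < 0 := by
    by_contra hh
    push Not at hh
    nlinarith [mul_nonneg hh hτ.le]
  have hcp : ContinuousAt ψ p := hc.continuousAt (Icc_mem_nhds hp hpβ)
  obtain ⟨w, hw⟩ : ∃ w : ℝ → ℝ, w = fun r => s / ψ r := ⟨_, rfl⟩
  obtain ⟨wb, hwb⟩ : ∃ wb : ℝ → ℝ, wb = fun r => (μ - r * w r) / β := ⟨_, rfl⟩
  have hcw : ContinuousAt w p := by rw [hw]; exact continuousAt_const.div hcp hpn.ne
  have hcwb : ContinuousAt wb p := by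
    rw [hwb]; exact (continuousAt_const.sub (continuousAt_id.mul hcw)).div_const β
  have hwψ : ∀ r, 0 < r → r < β → w r * ψ r = s := by
    intro r hr hrβ
    have := (neg_in hcv h0 hβ0 hr hrβ).ne
    rw [hw]; field_simp
  have hwpos : ∀ r, 0 < r → r < β → 0 < w r := by
    intro r hr hrβ
    rw [hw]; exact div_pos_of_neg_of_neg hsn (neg_in hcv h0 hβ0 hr hrβ)
  have hbw : ∀ r, β * wb r = μ - r * w r := by intro r; rw [hwb]; field_simp
  have hwbpos : ∀ r, 0 < r → r < τ → 0 < wb r := by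
    intro r hr hrτ
    have h1 := slope0 hcv h0 hr hrτ hτβ.le
    have h2 := hwψ r hr (by linarith)
    have h3 := neg_in hcv h0 hβ0 hr (by linarith : r < β)
    have h4 : r * w r < μ := by
      by_contra hh
      push Not at hh
      have h5 : r * w r * ψ r ≤ μ * ψ r := mul_le_mul_of_nonpos_right hh h3.le
      have h6 : r * s ≤ μ * ψ r := by rw [← h2]; linarith
      have h7 := mul_le_mul_of_nonneg_right h6 hτ.le
      have h8 := mul_lt_mul_of_pos_left h1 hμ
      nlinarith
    have := hbw r
    by_contra hh
    push Not at hh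
    nlinarith
  have hwbp : 0 ≤ wb p := by
    rcases hpτ.lt_or_eq with h | h
    · exact (hwbpos p hp h).le
    · have h2 := hwψ p hp hpβ
      have h3 : p * w p = μ := by
        rw [← h, ← h2] at hs
        have : (p * w p - μ) * ψ p = 0 := by linarith
        rcases mul_eq_zero.1 this with h | h
        · linarith
        · exact absurd h hpn.ne
      rw [hwb]; simp only; rw [h3]; simp
  have hw0 : ∀ r, 0 < r → r < β → ψ r * (β - μ) < s * (β - r) → 0 ≤ 1 - w r - wb r := by
    intro r hr hrβ h
    have h2 := hwψ r hr hrβ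
    have h3 := neg_in hcv h0 hβ0 hr hrβ
    have h4 := hbw r
    by_contra hh
    push Not at hh
    have h5 : (1 - w r - wb r) * β < 0 := mul_neg_of_neg_of_pos hh hβ
    have h6 : 0 < (β - μ - w r * (β - r)) * ψ r := mul_pos_of_neg_of_neg (by linarith) h3
    rw [← h2] at h
    linarith
  have hmem : ∀ r, 0 < r → r < β → ψ r * (β - μ) < s * (β - r) → 0 ≤ wb r →
      Q3 (1 - w r - wb r) (w r) (wb r) 0 r β ∈ amb μ s β ψ := by
    intro r hr hrβ h hb
    refine Q3_mem (hw0 r hr hrβ h) (hwpos r hr hrβ).le hb ⟨le_rfl, hβ.le⟩ ⟨hr.le, hrβ.le⟩ ⟨hβ.le, le_rfl⟩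
      (by ring) ?_ ?_
    · linarith [hbw r]
    · rw [h0, hβ0, hwψ r hr hrβ]; ring
  have hQp := hmem p hp hpβ hcase hwbp
  have hTp : tail (Q3 (1 - w p - wb p) (w p) (wb p) 0 p β) p = w p + wb p := by
    rw [Q3_tail (hw0 p hp hpβ hcase) (hwpos p hp hpβ).le hwbp, if_neg (not_le.2 hp), if_pos le_rfl,
      if_pos hpβ.le]; ring
  have hwp := hwpos p hp hpβ
  -- convexity bounds on the ratio
  have th1 : ∀ x, 0 ≤ x → x ≤ p → x ≤ p * (ψ x / ψ p) := by
    intro x hx hxp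
    have : ψ x * p ≤ ψ p * x := by
      rcases hx.lt_or_eq with h | h
      · rcases hxp.lt_or_eq with h' | h'
        · exact (slope0 hcv h0 h h' hpβ.le).le
        · rw [h']
      · rw [← h, h0]; simp
    have h2 : p * (ψ x / ψ p) = (ψ x * p) / ψ p := by ring
    rw [h2, le_div_iff_of_neg hpn]; linarith
  have th2 : ∀ x, p ≤ x → x ≤ β → β - x ≤ (β - p) * (ψ x / ψ p) := by
    intro x hx hxp
    have : ψ x * (β - p) ≤ ψ p * (β - x) := by
      rcases hx.lt_or_eq with h | h
      · rcases hxp.lt_or_eq with h' | h'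
        · have := chord hcv hp.le h h' le_rfl
          rw [hβ0] at this; linarith
        · rw [h', hβ0]; simp
      · rw [← h]
    have h2 : (β - p) * (ψ x / ψ p) = (ψ x * (β - p)) / ψ p := by ring
    rw [h2, le_div_iff_of_neg hpn]; linarith
  have hup : ∀ P ∈ amb μ s β ψ, ∀ t, 0 < t → t ≤ p → t * tail P t ≤ p * (w p + wb p) := by
    intro P hP t ht htp
    have := dual_up (t := t) (u := t) (a := p / β) (δ := p * (1 - p / β) / ψ p) (c := 0) hc hP (by
      intro x hx
      have e : p / β * x + p * (1 - p / β) / ψ p * ψ x + 0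
          = (p * x + p * (β - p) * (ψ x / ψ p)) / β := by field_simp; ring
      rw [e, le_div_iff₀ hβ]
      rcases le_total x p with h | h
      · have h1 := mul_le_mul_of_nonneg_left (th1 x hx.1 h) (by linarith : 0 ≤ β - p)
        split_ifs with h2
        · have := mul_le_mul_of_nonneg_right h2 hβ.le
          nlinarith
        · nlinarith [mul_nonneg hx.1 hβ.le]
      · have h1 := mul_le_mul_of_nonneg_left (th2 x h hx.2) hp.le
        rw [if_pos (by linarith)]
        have := mul_le_mul_of_nonneg_right htp hβ.le
        nlinarith)
    refine this.trans (le_of_eq ?_)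
    have hh : wb p = (μ - p * w p) / β := by rw [hwb]
    have hh2 : w p = s / ψ p := by rw [hw]
    rw [hh, hh2]
    have := hpn.ne
    field_simp
    ring
  have hlo : ∀ P ∈ amb μ s β ψ, wb p ≤ tail P p := by
    intro P hP
    have := dual_up (t := p) (u := -1) (a := - (1 / β)) (δ := p / β / ψ p) (c := 0) hc hP (by
      intro x hx
      have e : - (1 / β) * x + p / β / ψ p * ψ x + 0
          = (p * (ψ x / ψ p) - x) / β := by field_simp; ring
      rw [e, le_div_iff₀ hβ]
      split_ifs with h
      · have h1 := th2 x h hx.2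
        have h2 : 0 ≤ ψ x / ψ p := by
          by_contra hh
          push Not at hh
          nlinarith [hx.2]
        nlinarith [mul_nonneg hp.le h2, hx.2]
      · push Not at h
        linarith [th1 x hx.1 h.le])
    have hh : wb p = (μ - p * w p) / β := by rw [hwb]
    have hh2 : w p = s / ψ p := by rw [hw]
    have e : - (1 / β) * μ + p / β / ψ p * s + 0 = - wb p := by
      rw [hh, hh2]
      have := hpn.ne
      field_simp
      ring
    rw [e] at this
    linarith
  have hSge : w p + wb p ≤ sSup ((fun P => tail P p) '' amb μ s β ψ) :=
    le_csSup (bddA μ s β ψ p) ⟨_, hQp, hTp⟩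
  have hSle : sSup ((fun P => tail P p) '' amb μ s β ψ) ≤ w p + wb p := by
    refine csSup_le ⟨_, _, hQp, rfl⟩ ?_
    rintro _ ⟨P, hP, rfl⟩
    exact le_of_mul_le_mul_left (hup P hP p hp le_rfl) hp
  have hS := le_antisymm hSle hSge
  refine le_antisymm ?_ ?_
  · have hev : ∃ l, 0 ≤ l ∧ l < p ∧ ∀ r, l < r → r < p → ψ r * (β - μ) < s * (β - r) := by
      have : ∀ᶠ r in nhds p, ψ r * (β - μ) < s * (β - r) := by
        refine Filter.Tendsto.eventually_lt (y := ψ p * (β - μ)) (z := s * (β - p)) ?_ ?_ hcase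
        · exact (hcp.mul continuousAt_const)
        · exact (continuousAt_const.mul (continuousAt_const.sub continuousAt_id))
      obtain ⟨ε, hε, h⟩ := Metric.eventually_nhds_iff.1 this
      refine ⟨max 0 (p - ε), le_max_left _ _, max_lt hp (by linarith), fun r hr hrp => h ?_⟩
      have := (max_lt_iff.1 hr).2
      rw [Real.dist_eq, abs_lt]; constructor <;> linarith
    obtain ⟨l, hl0, hlp, hl⟩ := hev
    have hX := fun (Q : Measure ℝ) (hQ : Q ∈ amb μ s β ψ) (t : ℝ) (ht : 0 < t) =>
        X_mul_le hμ hβ hc hp hQ ht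
    have hX0 := X_nonneg (s := s) hμ hβ hc hp
    generalize sInf ((fun P => CR p P) '' amb μ s β ψ) = X at *
    have hQr : ∀ r, l < r → r < p → ∃ Q ∈ amb μ s β ψ, 0 < wb r ∧ tail Q p = wb r ∧
        tail Q β = wb r ∧ tail Q r = w r + wb r := by
      intro r hlr hrp
      have hr : 0 < r := by linarith
      have hrβ : r < β := by linarith
      have hb := hwbpos r hr (by linarith)
      refine ⟨_, hmem r hr hrβ (hl r hlr hrp) hb.le, hb, ?_, ?_, ?_⟩
      · rw [Q3_tail (hw0 r hr hrβ (hl r hlr hrp)) (hwpos r hr hrβ).le hb.le, if_neg (not_le.2 hp),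
          if_neg (not_le.2 hrp), if_pos hpβ.le]; ring
      · rw [Q3_tail (hw0 r hr hrβ (hl r hlr hrp)) (hwpos r hr hrβ).le hb.le, if_neg (not_le.2 hβ),
          if_neg (not_le.2 hrβ), if_pos le_rfl]; ring
      · rw [Q3_tail (hw0 r hr hrβ (hl r hlr hrp)) (hwpos r hr hrβ).le hb.le, if_neg (not_le.2 hr),
          if_pos le_rfl, if_pos hrβ.le]; ring
    refine le_min ?_ ?_
    · rw [hS, le_div_iff₀ (by linarith)]
      have := lim_le (f := fun r => X * (r * (w r + wb r))) (g := fun r => p * wb r) (p := p)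
        (by fun_prop) (by fun_prop) hlp (by
          intro r hlr hrp
          obtain ⟨Q, hQ, hb, t1, t2, t3⟩ := hQr r hlr hrp
          have := hX Q hQ r (by linarith)
          rw [t1, t3] at this
          exact this)
      have h2 : p * (X * (w p + wb p)) ≤ p * wb p := by linarith
      refine (le_of_mul_le_mul_left h2 hp).trans ?_
      refine le_csInf ⟨_, _, hQp, rfl⟩ ?_
      rintro _ ⟨P, hP, rfl⟩
      exact hlo P hP
    · obtain ⟨Q, hQ, hb, t1, t2, t3⟩ := hQr ((l + p) / 2) (by linarith) (by linarith)
      have hq : 0 < tail Q p := by rw [t1]; exact hb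
      have hCpos : 0 < sSup ((fun P => condMean P p) '' {P ∈ amb μ s β ψ | 0 < tail P p}) :=
        lt_of_lt_of_le (lt_of_lt_of_le hp (condMean_bounds hQ hq).1)
          (le_csSup (bddC μ s β ψ p) ⟨_, ⟨hQ, hq⟩, rfl⟩)
      have hCle : sSup ((fun P => condMean P p) '' {P ∈ amb μ s β ψ | 0 < tail P p}) ≤ β := by
        refine csSup_le ⟨_, _, ⟨hQ, hq⟩, rfl⟩ ?_
        rintro _ ⟨P, hP, rfl⟩
        exact (condMean_bounds hP.1 hP.2).2.1
      have h := hX Q hQ β hβ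
      rw [t1, t2, ← mul_assoc] at h
      have h2 := le_of_mul_le_mul_right h hb
      rw [le_div_iff₀ hCpos]
      exact (mul_le_mul_of_nonneg_left hCle hX0).trans h2
  · refine le_csInf ⟨_, _, hQp, rfl⟩ ?_
    rintro _ ⟨P, hP, rfl⟩
    refine lower hμ hβ hc hP hp fun t ht htp => ?_
    rw [hS]
    exact hup P hP t ht htp.le

lemma core {μ s β τ p : ℝ} {ψ : ℝ → ℝ} (hμ : 0 < μ) (hμτ : μ ≤ τ) (hτβ : τ < β)
    (hcv : StrictConvexOn ℝ (Icc 0 β) ψ) (hc : ContinuousOn ψ (Icc 0 β)) (h0 : ψ 0 = 0)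
    (hβ0 : ψ β = 0) (hs : s * τ = μ * ψ τ) (hp : 0 < p) :
    sInf ((fun P => CR p P) '' amb μ s β ψ) =
        min (sInf ((fun P => tail P p) '' amb μ s β ψ) /
              sSup ((fun P => tail P p) '' amb μ s β ψ))
            (p / sSup ((fun P => condMean P p) '' {P ∈ amb μ s β ψ | 0 < tail P p})) := by
  have hτ : 0 < τ := by linarith
  have hβ : 0 < β := by linarith
  have k1 : 0 < μ / τ := by positivity
  have k2 : μ / τ ≤ 1 := by rw [div_le_one hτ]; exact hμτ
  have hA : Q3 (1 - μ / τ) (μ / τ) 0 0 τ 0 ∈ amb μ s β ψ := by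
    refine Q3_mem (by linarith) k1.le le_rfl ⟨le_rfl, hβ.le⟩ ⟨hτ.le, hτβ.le⟩ ⟨le_rfl, hβ.le⟩
      (by ring) (by field_simp; ring) ?_
    rw [h0]; field_simp; linarith
  rcases le_or_gt p τ with hpτ | hpτ
  · rcases le_or_gt (s * (β - p)) (ψ p * (β - μ)) with h | h
    · exact case2 hμ hμτ hτβ hcv hc h0 hβ0 hs hp hpτ hA h
    · exact case1 hμ hμτ hτβ hcv hc h0 hβ0 hs hp hpτ h
  · have hT : tail (Q3 (1 - μ / τ) (μ / τ) 0 0 τ 0) p = 0 := by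
      rw [Q3_tail (by linarith) k1.le le_rfl, if_neg (not_le.2 hp), if_neg (not_le.2 hpτ)]; ring
    have hX : sInf ((fun P => CR p P) '' amb μ s β ψ) = 0 := by
      refine le_antisymm ?_ (X_nonneg hμ hβ hc hp)
      refine (X_le hμ hβ hc hp hA).trans ?_
      unfold CR REV
      rw [hT]; simp
    have hI : sInf ((fun P => tail P p) '' amb μ s β ψ) = 0 := by
      refine le_antisymm ?_ (Real.sInf_nonneg (by rintro _ ⟨P, _, rfl⟩; exact tail_nonneg P p))
      exact csInf_le (bddB μ s β ψ p) ⟨_, hA, hT⟩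
    have hC0 : 0 ≤ sSup ((fun P => condMean P p) '' {P ∈ amb μ s β ψ | 0 < tail P p}) :=
      Real.sSup_nonneg (by
        rintro _ ⟨P, hP, rfl⟩; exact hp.le.trans (condMean_bounds hP.1 hP.2).1)
    rw [hX, hI, zero_div, min_eq_left (div_nonneg hp.le hC0)]

/-- **Competitive ratio decomposition** (Theorem 1). -/
theorem competitive_ratio_decomposition
    (μ β s τ₂ : ℝ) (φ : ℝ → ℝ)
    (hμ : 0 < μ) (hβ : 0 < β) (hs : 0 < s)
    (hconv : StrictConvexOn ℝ (Icc 0 β) φ)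
    (hdiff : DifferentiableOn ℝ φ (Icc 0 β))
    (hnonneg : ∀ x ∈ Icc (0:ℝ) β, 0 ≤ φ x)
    (hτ₂pos : 0 < τ₂)
    (hτ₂eq : (s - φ 0) / μ = (φ τ₂ - φ 0) / τ₂)
    (hμτ : μ ≤ τ₂) (hτβ : τ₂ < β) :
    ∀ p ∈ Ioc (0:ℝ) β,
      sInf ((fun P => CR p P) '' amb μ s β φ) =
        min (sInf ((fun P => tail P p) '' amb μ s β φ) /
              sSup ((fun P => tail P p) '' amb μ s β φ))
            (p / sSup ((fun P => condMean P p) '' {P ∈ amb μ s β φ | 0 < tail P p})) := by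
  intro p hp
  have hc := hdiff.continuousOn
  rw [amb_shift μ s β φ hc (φ 0) ((φ β - φ 0) / β)]
  refine core hμ hμτ hτβ ?_ ?_ (by simp) (by field_simp; ring) ?_ hp.1
  · have h2 : ConvexOn ℝ (Icc 0 β) (fun x => - φ 0 + (-((φ β - φ 0) / β)) * x) := by
      refine ⟨convex_Icc 0 β, fun x _ y _ a b _ _ hab => le_of_eq ?_⟩
      simp only [smul_eq_mul]
      have : b = 1 - a := by linarith
      subst this; ring
    have := hconv.add_convexOn h2
    refine this.congr fun x _ => ?_
    simp only [Pi.add_apply]; ring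
  · fun_prop
  · rw [div_eq_div_iff hμ.ne' hτ₂pos.ne'] at hτ₂eq
    linear_combination hτ₂eq
end

section
/- Non-emptiness of the ambiguity set: Fix 0 < μ, β > 0, s > 0 and a strictly convex differentiable dispersion function φ : [0,β] → ℝ≥0 (extended to [0,∞) so the defining equation for τ₂ makes sense), and let τ₂ > 0 satisfy (s − φ(0))/μ = (φ(τ₂) − φ(0))/τ₂. Then the ambiguity set 𝒫(μ,s,β,φ) is nonempty if and only if μ ≤ τ₂ ≤ β. -/
open MeasureTheory Set

/-- **Non-emptiness of the ambiguity set** (Lemma 1): `𝒫(μ,s,β,φ)` is nonempty if and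
only if `μ ≤ τ₂ ≤ β`, where `τ₂ > 0` solves `(s − φ(0))/μ = (φ(τ₂) − φ(0))/τ₂` and the
dispersion function `φ` is strictly convex, differentiable and nonnegative on `[0,∞)`. -/
theorem ambiguity_set_nonempty_iff
    (μ β s τ₂ : ℝ) (φ : ℝ → ℝ)
    (hμ : 0 < μ) (hβ : 0 < β) (hs : 0 < s)
    (hconv : StrictConvexOn ℝ (Ici 0) φ)
    (hdiff : DifferentiableOn ℝ φ (Ici 0))
    (hnonneg : ∀ x ∈ Ici (0:ℝ), 0 ≤ φ x)
    (hτ₂pos : 0 < τ₂)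
    (hτ₂eq : (s - φ 0) / μ = (φ τ₂ - φ 0) / τ₂) :
    (amb μ s β φ).Nonempty ↔ (μ ≤ τ₂ ∧ τ₂ ≤ β) := by
  have key : ∀ x y : ℝ, 0 < x → 0 < y → (φ x - φ 0) / x ≤ (φ y - φ 0) / y → x ≤ y := by
    intro x y hx hy h
    by_contra hlt
    push Not at hlt
    have := hconv.secant_strict_mono (a := 0) (x := y) (y := x) (by simp) hy.le hx.le
      hy.ne' hx.ne' hlt
    simp only [sub_zero] at this
    linarith
  constructor
  · rintro ⟨P, hP, hsupp, hmean, hdisp⟩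
    have hae : ∀ᵐ x ∂P, x ∈ Icc 0 β := by
      rw [← prob_compl_eq_zero_iff measurableSet_Icc] at hsupp
      exact hsupp
    have hres : P.restrict (Icc 0 β) = P := Measure.restrict_eq_self_of_ae_mem hae
    have hsub : Icc 0 β ⊆ Ici (0:ℝ) := fun x hx => hx.1
    have hcont : ContinuousOn φ (Ici 0) := hdiff.continuousOn
    have hintφ : Integrable φ P := by
      have h := (hcont.mono hsub).integrableOn_compact (μ := P) isCompact_Icc
      rwa [IntegrableOn, hres] at h
    have hintx : Integrable (fun x : ℝ => x) P := by
      have h := (continuousOn_id (s := Icc 0 β)).integrableOn_compact (μ := P) isCompact_Icc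
      rwa [IntegrableOn, hres] at h
    constructor
    · apply key _ _ hμ hτ₂pos
      rw [← hτ₂eq]
      have hJ := hconv.convexOn.map_integral_le (μ := P) (f := fun x : ℝ => x) hcont isClosed_Ici
        (hae.mono fun x hx => hsub hx) hintx hintφ
      rw [hmean] at hJ
      have hJ' : φ μ ≤ s := by rw [← hdisp]; exact hJ
      gcongr
    · apply key _ _ hτ₂pos hβ
      rw [← hτ₂eq]
      have hle : (∫ x, φ x ∂P) ≤ ∫ x, (φ 0 + (φ β - φ 0) / β * x) ∂P := by
        apply integral_mono_ae hintφ ((integrable_const _).add (hintx.const_mul _))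
        filter_upwards [hae] with x hx
        have h1 : x / β ≤ 1 := (div_le_one hβ).2 hx.2
        have h2 : 0 ≤ x / β := div_nonneg hx.1 hβ.le
        have h := hconv.convexOn.2 (x := 0) (y := β) (by simp) hβ.le
          (sub_nonneg.2 h1) h2 (by ring)
        simp only [smul_eq_mul, mul_zero, zero_add, div_mul_cancel₀ _ hβ.ne'] at h
        calc φ x ≤ _ := h
          _ = _ := by simp only [Pi.add_apply]; ring
      rw [integral_add (integrable_const _) (hintx.const_mul _), integral_const_mul, hmean,
        hdisp] at hle
      simp only [integral_const, probReal_univ, one_smul] at hle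
      rw [div_le_iff₀ hμ]
      linarith
  · rintro ⟨h1, h2⟩
    have hp0 : 0 ≤ μ / τ₂ := by positivity
    have hp1 : 0 ≤ 1 - μ / τ₂ := sub_nonneg.2 ((div_le_one hτ₂pos).2 h1)
    have hsum : ENNReal.ofReal (1 - μ / τ₂) + ENNReal.ofReal (μ / τ₂) = 1 := by
      rw [← ENNReal.ofReal_add hp1 hp0]; simp
    have hint : ∀ f : ℝ → ℝ, ∫ x, f x ∂(ENNReal.ofReal (1 - μ / τ₂) • Measure.dirac (0:ℝ)
        + ENNReal.ofReal (μ / τ₂) • Measure.dirac τ₂) = (1 - μ / τ₂) * f 0 + μ / τ₂ * f τ₂ := by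
      intro f
      rw [integral_add_measure, integral_smul_measure, integral_smul_measure, integral_dirac,
        integral_dirac, ENNReal.toReal_ofReal hp0, ENNReal.toReal_ofReal hp1]
      · simp
      · exact (integrable_dirac (by simp)).smul_measure ENNReal.ofReal_ne_top
      · exact (integrable_dirac (by simp)).smul_measure ENNReal.ofReal_ne_top
    refine ⟨ENNReal.ofReal (1 - μ / τ₂) • Measure.dirac (0:ℝ)
        + ENNReal.ofReal (μ / τ₂) • Measure.dirac τ₂, ⟨?_⟩, ?_, ?_, ?_⟩
    · simpa using hsum
    · have ha : (0:ℝ) ∈ Icc 0 β := ⟨le_rfl, hβ.le⟩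
      have hb : τ₂ ∈ Icc 0 β := ⟨hτ₂pos.le, h2⟩
      rw [Measure.add_apply, Measure.smul_apply, Measure.smul_apply,
        Measure.dirac_apply_of_mem ha, Measure.dirac_apply_of_mem hb]
      simpa using hsum
    · rw [hint (fun x => x)]
      field_simp
      ring
    · rw [hint]
      rw [div_eq_iff hμ.ne'] at hτ₂eq
      have : s = φ 0 + (φ τ₂ - φ 0) / τ₂ * μ := by linarith
      rw [this]
      ring
end

section
/- Best-case tail probability: Fix 0 < μ, β > 0, s > 0 and a strictly convex differentiable dispersion function φ : [0,β] → ℝ≥0, assume μ ≤ τ₂ < β, let τ₁ ∈ [0,μ) satisfy φ(τ₁)·(β−μ)/(β−τ₁) + φ(β)·(μ−τ₁)/(β−τ₁) = s, and for p ∈ [τ₂,β] let α(p) ∈ [0,μ) satisfy φ(α(p))·(μ−p)/(α(p)−p) + φ(p)·(α(p)−μ)/(α(p)−p) = s. Then sup_{P ∈ 𝒫(μ,s,β,φ)} P(X ≥ p) equals 1 for p ∈ (0,τ₁], equals w_p(p) + w_β(p) for p ∈ [τ₁,τ₂], and equals (μ − α(p))/(p − α(p)) for p ∈ [τ₂,β];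 moreover this function of p is continuous on (0,β]. -/
open MeasureTheory Set

/-- Common denominator `D(p) = β(φ(0) − φ(p)) + p(φ(β) − φ(0))` of the three-point weights. -/
noncomputable def D (β : ℝ) (φ : ℝ → ℝ) (p : ℝ) : ℝ :=
  β * (φ 0 - φ p) + p * (φ β - φ 0)

/-- Weight of the three-point distribution at `p`. -/
noncomputable def wP (μ β s : ℝ) (φ : ℝ → ℝ) (p : ℝ) : ℝ :=
  (β * (φ 0 - s) + μ * (φ β - φ 0)) / D β φ p

/-- Weight of the three-point distribution at `β`. -/
noncomputable def wB (μ β s : ℝ) (φ : ℝ → ℝ) (p : ℝ) : ℝ :=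
  (μ * (φ 0 - φ p) - p * (φ 0 - s)) / D β φ p


lemma amb_ae {μ s β : ℝ} {φ : ℝ → ℝ} {P : Measure ℝ} (hP : P ∈ amb μ s β φ) :
    ∀ᵐ x ∂P, x ∈ Icc (0:ℝ) β := by
  obtain ⟨h1, h2, -, -⟩ := hP
  exact (mem_ae_iff_prob_eq_one measurableSet_Icc).2 h2

lemma upper_bd {μ s β p : ℝ} {φ : ℝ → ℝ} (hc : ContinuousOn φ (Icc 0 β))
    {P : Measure ℝ} (hP : P ∈ amb μ s β φ) (a b c : ℝ)
    (h0 : ∀ x ∈ Icc (0:ℝ) β, 0 ≤ a + b * x + c * φ x)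
    (h1 : ∀ x ∈ Icc (0:ℝ) β, p ≤ x → 1 ≤ a + b * x + c * φ x) :
    tail P p ≤ a + b * μ + c * s := by
  have hae := amb_ae hP
  obtain ⟨hpr, h2, h3, h4⟩ := hP
  have hres : P.restrict (Icc 0 β) = P := Measure.restrict_eq_self_of_ae_mem hae
  have key : ∀ f : ℝ → ℝ, ContinuousOn f (Icc 0 β) → Integrable f P := by
    intro f hf
    have := hf.integrableOn_compact (μ := P) isCompact_Icc
    rw [IntegrableOn, hres] at this
    exact this
  have ix : Integrable (fun x : ℝ => b * x) P := (key _ continuousOn_id).const_mul b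
  have iφ : Integrable (fun x : ℝ => c * φ x) P := (key _ hc).const_mul c
  have iax : Integrable (fun x : ℝ => a + b * x) P := (integrable_const a).add ix
  have hE : ∫ x, (a + b * x + c * φ x) ∂P = a + b * μ + c * s := by
    rw [integral_add iax iφ, integral_add (integrable_const a) ix,
      integral_const_mul, integral_const_mul, h3, h4]
    simp
  rw [← hE]
  have : tail P p = ∫ x, (Ici p).indicator (1 : ℝ → ℝ) x ∂P := by
    rw [integral_indicator_one measurableSet_Ici]; rfl
  rw [this]
  apply integral_mono_ae
  · exact (integrable_const (1:ℝ)).indicator measurableSet_Ici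
  · exact iax.add iφ
  · filter_upwards [hae] with x hx
    by_cases hpx : p ≤ x
    · simpa [indicator, hpx] using h1 x hx hpx
    · simpa [indicator, hpx] using h0 x hx

lemma three_pt {μ s β p : ℝ} {φ : ℝ → ℝ} (w0 w1 w2 x0 x1 x2 : ℝ)
    (hw0 : 0 ≤ w0) (hw1 : 0 ≤ w1) (hw2 : 0 ≤ w2) (hw : w0 + w1 + w2 = 1)
    (h0 : x0 ∈ Icc 0 β) (h1 : x1 ∈ Icc 0 β) (h2 : x2 ∈ Icc 0 β)
    (hm : w0 * x0 + w1 * x1 + w2 * x2 = μ)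
    (hs : w0 * φ x0 + w1 * φ x1 + w2 * φ x2 = s)
    (hp0 : x0 < p) (hp1 : p ≤ x1) (hp2 : p ≤ x2) :
    ∃ P ∈ amb μ s β φ, tail P p = w1 + w2 := by
  let P : Measure ℝ := ENNReal.ofReal w0 • Measure.dirac x0 + ENNReal.ofReal w1 • Measure.dirac x1
      + ENNReal.ofReal w2 • Measure.dirac x2
  have hsum : ENNReal.ofReal w0 + ENNReal.ofReal w1 + ENNReal.ofReal w2 = 1 := by
    rw [← ENNReal.ofReal_add hw0 hw1, ← ENNReal.ofReal_add (by positivity) hw2, hw]; simp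
  have hint : ∀ f : ℝ → ℝ, ∫ x, f x ∂P = w0 * f x0 + w1 * f x1 + w2 * f x2 := by
    intro f
    have hi : ∀ (w x : ℝ), Integrable f (ENNReal.ofReal w • Measure.dirac x) := fun w x =>
      (integrable_dirac (by finiteness)).smul_measure (by finiteness)
    rw [integral_add_measure ((hi _ _).add_measure (hi _ _)) (hi _ _),
      integral_add_measure (hi _ _) (hi _ _)]
    simp [integral_smul_measure, hw0, hw1, hw2]
  refine ⟨P, ⟨⟨?_⟩, ?_, ?_, ?_⟩, ?_⟩
  · simp [P, hsum]
  · have h0' := h0; have h1' := h1; have h2' := h2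
    simp only [P, Measure.add_apply, Measure.smul_apply, Measure.dirac_apply' _ measurableSet_Icc,
      indicator_of_mem h0, indicator_of_mem h1, indicator_of_mem h2]
    simpa using hsum
  · rw [hint, hm]
  · rw [hint, hs]
  · have e0 : x0 ∉ Ici p := by simpa using hp0
    have e1 : x1 ∈ Ici p := hp1
    have e2 : x2 ∈ Ici p := hp2
    simp only [tail, P, Measure.add_apply, Measure.smul_apply,
      Measure.dirac_apply' _ measurableSet_Ici,
      indicator_of_notMem e0, indicator_of_mem e1, indicator_of_mem e2]
    simp [ENNReal.toReal_add, hw1, hw2]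

lemma sup_eq {μ s β p v : ℝ} {φ : ℝ → ℝ}
    (h1 : ∃ P ∈ amb μ s β φ, tail P p = v) (h2 : ∀ P ∈ amb μ s β φ, tail P p ≤ v) :
    sSup ((fun P => tail P p) '' amb μ s β φ) = v := by
  apply IsGreatest.csSup_eq
  refine ⟨?_, ?_⟩
  · obtain ⟨P, hP, h⟩ := h1
    exact ⟨P, hP, h⟩
  · rintro _ ⟨P, hP, rfl⟩
    exact h2 P hP

lemma sc3 {β : ℝ} {φ : ℝ → ℝ} (hconv : StrictConvexOn ℝ (Icc 0 β) φ) {x y z : ℝ}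
    (hx : 0 ≤ x) (hxy : x < y) (hyz : y < z) (hz : z ≤ β) :
    φ y * (z - x) < φ x * (z - y) + φ z * (y - x) := by
  have hzx : 0 < z - x := by linarith
  have h := hconv.2 (show x ∈ Icc 0 β from ⟨hx, by linarith⟩) (show z ∈ Icc 0 β from ⟨by linarith, hz⟩)
    (by linarith) (show 0 < (z - y) / (z - x) from div_pos (by linarith) hzx)
    (show 0 < (y - x) / (z - x) from div_pos (by linarith) hzx) (by field_simp; ring)
  simp only [smul_eq_mul] at h
  have e : (z - y) / (z - x) * x + (y - x) / (z - x) * z = y := by field_simp; ring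
  rw [e] at h
  have e2 : (z - y) / (z - x) * φ x + (y - x) / (z - x) * φ z
    = (φ x * (z - y) + φ z * (y - x)) / (z - x) := by field_simp
  rw [e2, lt_div_iff₀ hzx] at h
  exact h

lemma sc3le {β : ℝ} {φ : ℝ → ℝ} (hconv : StrictConvexOn ℝ (Icc 0 β) φ) {x y z : ℝ}
    (hx : 0 ≤ x) (hxy : x ≤ y) (hyz : y ≤ z) (hz : z ≤ β) :
    φ y * (z - x) ≤ φ x * (z - y) + φ z * (y - x) := by
  rcases hxy.eq_or_lt with rfl | h1
  · simp
  rcases hyz.eq_or_lt with rfl | h2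
  · simp
  exact (sc3 hconv hx h1 h2 hz).le

lemma subgrad {β : ℝ} {φ : ℝ → ℝ} (hconv : StrictConvexOn ℝ (Icc 0 β) φ)
    (hdiff : DifferentiableOn ℝ φ (Icc 0 β)) {a : ℝ} (ha : a ∈ Icc 0 β) :
    ∃ m, ∀ x ∈ Icc 0 β, φ a + m * (x - a) ≤ φ x := by
  have hd := (hdiff a ha).hasDerivWithinAt
  refine ⟨derivWithin φ (Icc 0 β) a, fun x hx => ?_⟩
  rcases lt_trichotomy x a with h | rfl | h
  · have := hconv.convexOn.slope_le_of_hasDerivWithinAt hx ha h hd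
    rw [slope_def_field, div_le_iff₀ (by linarith)] at this
    linarith
  · simp
  · have := hconv.convexOn.le_slope_of_hasDerivWithinAt ha hx h hd
    rw [slope_def_field, le_div_iff₀ (by linarith)] at this
    linarith

/-- **Best-case tail probability** (Proposition 1): branchwise formula for
`sup_{P ∈ 𝒫(μ,s,β,φ)} P(X ≥ p)`, together with its continuity on `(0,β]`. -/
theorem best_case_tail_probability
    (μ β s τ₁ τ₂ : ℝ) (φ : ℝ → ℝ) (α : ℝ → ℝ)
    (hμ : 0 < μ) (hβ : 0 < β) (hs : 0 < s)
    (hconv : StrictConvexOn ℝ (Icc 0 β) φ)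
    (hdiff : DifferentiableOn ℝ φ (Icc 0 β))
    (hnonneg : ∀ x ∈ Icc (0:ℝ) β, 0 ≤ φ x)
    (hτ₂pos : 0 < τ₂)
    (hτ₂eq : (s - φ 0) / μ = (φ τ₂ - φ 0) / τ₂)
    (hμτ₂ : μ ≤ τ₂) (hτ₂β : τ₂ < β)
    (hτ₁mem : τ₁ ∈ Ico (0:ℝ) μ)
    (hτ₁eq : φ τ₁ * ((β - μ) / (β - τ₁)) + φ β * ((μ - τ₁) / (β - τ₁)) = s)
    (hαmem : ∀ p ∈ Icc τ₂ β, α p ∈ Ico (0:ℝ) μ)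
    (hαeq : ∀ p ∈ Icc τ₂ β,
      φ (α p) * ((μ - p) / (α p - p)) + φ p * ((α p - μ) / (α p - p)) = s) :
    (∀ p ∈ Ioc (0:ℝ) τ₁,
        sSup ((fun P => tail P p) '' amb μ s β φ) = 1) ∧
    (∀ p ∈ Icc τ₁ τ₂,
        sSup ((fun P => tail P p) '' amb μ s β φ) = wP μ β s φ p + wB μ β s φ p) ∧
    (∀ p ∈ Icc τ₂ β,
        sSup ((fun P => tail P p) '' amb μ s β φ) = (μ - α p) / (p - α p)) ∧
    ContinuousOn (fun p => sSup ((fun P => tail P p) '' amb μ s β φ)) (Ioc 0 β) := by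
  have hc : ContinuousOn φ (Icc 0 β) := hdiff.continuousOn
  obtain ⟨hτ₁0, hτ₁μ⟩ := hτ₁mem
  have hμβ : μ < β := by linarith
  have H2 : (s - φ 0) * τ₂ = (φ τ₂ - φ 0) * μ := by
    field_simp at hτ₂eq; linarith
  have H1 : φ τ₁ * (β - μ) + φ β * (μ - τ₁) = s * (β - τ₁) := by
    have : β - τ₁ ≠ 0 := by linarith
    field_simp at hτ₁eq; linarith
  have hμτ₂' : μ < τ₂ := by
    rcases hμτ₂.eq_or_lt with h | h
    · exfalso
      subst h
      have e : s = φ μ := by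
        have := mul_right_cancel₀ hμ.ne' H2
        linarith
      have := sc3 hconv hτ₁0 hτ₁μ hμβ le_rfl
      rw [← e] at this
      linarith
    · exact h
  have hNP : 0 < β * (φ 0 - s) + μ * (φ β - φ 0) := by
    have h := sc3 hconv le_rfl hτ₂pos hτ₂β le_rfl
    have e : τ₂ * (β * (φ 0 - s) + μ * (φ β - φ 0)) =
      μ * (φ 0 * (β - τ₂) + φ β * (τ₂ - 0) - φ τ₂ * (β - 0)) := by
      linear_combination (-β) * H2
    have : 0 < τ₂ * (β * (φ 0 - s) + μ * (φ β - φ 0)) := by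
      rw [e]; exact mul_pos hμ (by linarith)
    exact pos_of_mul_pos_right this hτ₂pos.le
  have hτ₁pos : 0 < τ₁ := by
    rcases hτ₁0.eq_or_lt with h | h
    · exfalso; subst h; linarith
    · exact h
  have hsμ : φ μ < s := by
    have h := sc3 hconv le_rfl hμ hμτ₂' hτ₂β.le
    have : φ μ * τ₂ < s * τ₂ := by linarith
    exact lt_of_mul_lt_mul_right this hτ₂pos.le
  have hDpos : ∀ p, 0 < p → p < β → 0 < D β φ p := by
    intro p h1 h2
    have := sc3 hconv le_rfl h1 h2 le_rfl
    unfold D; linarith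
  have Ha : ∀ p ∈ Icc τ₂ β, φ (α p) * (p - μ) + φ p * (μ - α p) = s * (p - α p) := by
    intro p hp
    have h := hαeq p hp
    have h1 := (hαmem p hp).2
    have : α p - p ≠ 0 := by linarith [hp.1]
    field_simp at h; linarith
  have B1 : ∀ p ∈ Ioc (0:ℝ) τ₁, sSup ((fun P => tail P p) '' amb μ s β φ) = 1 := by
    intro p hp
    have hb : 0 < β - τ₁ := by linarith
    apply sup_eq
    · obtain ⟨P, hP, h⟩ := three_pt (μ := μ) (s := s) (β := β) (p := p) (φ := φ)
        0 ((β - μ) / (β - τ₁)) ((μ - τ₁) / (β - τ₁)) 0 τ₁ β le_rfl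
        (div_nonneg (by linarith) hb.le) (div_nonneg (by linarith) hb.le)
        (by field_simp; ring) ⟨le_rfl, hβ.le⟩ ⟨hτ₁0, by linarith⟩ ⟨hβ.le, le_rfl⟩
        (by field_simp; ring) (by linarith) hp.1 hp.2 (by linarith [hp.2])
      refine ⟨P, hP, h.trans ?_⟩
      field_simp; ring
    · intro P hP
      have := upper_bd (p := p) hc hP 1 0 0 (by simp) (by simp)
      simpa using this
  have B2 : ∀ p ∈ Icc τ₁ τ₂,
      sSup ((fun P => tail P p) '' amb μ s β φ) = wP μ β s φ p + wB μ β s φ p := by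
    intro p hp
    have hp0 : 0 < p := by linarith [hp.1]
    have hpβ : p < β := by linarith [hp.2]
    have hD := hDpos p hp0 hpβ
    have hNB : 0 ≤ μ * (φ 0 - φ p) - p * (φ 0 - s) := by
      have h := sc3le hconv le_rfl hp0.le hp.2 hτ₂β.le
      have e : τ₂ * (μ * (φ 0 - φ p) - p * (φ 0 - s)) =
        μ * (φ 0 * (τ₂ - p) + φ τ₂ * (p - 0) - φ p * (τ₂ - 0)) := by
        linear_combination p * H2
      have : 0 ≤ τ₂ * (μ * (φ 0 - φ p) - p * (φ 0 - s)) := by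
        rw [e]; exact mul_nonneg hμ.le (by linarith)
      exact nonneg_of_mul_nonneg_right this hτ₂pos
    have hN0 : 0 ≤ s * (β - p) - φ p * (β - μ) - φ β * (μ - p) := by
      have h := sc3le hconv hτ₁0 hp.1 hpβ.le le_rfl
      have e : (β - τ₁) * (s * (β - p) - φ p * (β - μ) - φ β * (μ - p)) =
        (β - μ) * (φ τ₁ * (β - p) + φ β * (p - τ₁) - φ p * (β - τ₁)) := by
        linear_combination (-(β - p)) * H1
      have : 0 ≤ (β - τ₁) * (s * (β - p) - φ p * (β - μ) - φ β * (μ - p)) := by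
        rw [e]; exact mul_nonneg (by linarith) (by linarith)
      exact nonneg_of_mul_nonneg_right this (by linarith)
    have hDd : D β φ p = β * (φ 0 - φ p) + p * (φ β - φ 0) := rfl
    apply sup_eq
    · apply three_pt ((s * (β - p) - φ p * (β - μ) - φ β * (μ - p)) / D β φ p) _ _ 0 p β
        (div_nonneg hN0 hD.le) (div_nonneg hNP.le hD.le) (div_nonneg hNB hD.le)
        _ ⟨le_rfl, hβ.le⟩ ⟨hp0.le, hpβ.le⟩ ⟨hβ.le, le_rfl⟩ _ _ hp0 le_rfl hpβ.le
      · field_simp; rw [hDd]; ring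
      · field_simp; rw [hDd]; ring
      · field_simp; rw [hDd]; ring
    · intro P hP
      have := upper_bd (p := p) hc hP (-((p - β) / D β φ p) * φ 0) ((φ β - φ p) / D β φ p)
        ((p - β) / D β φ p) ?_ ?_
      · refine this.trans (le_of_eq ?_)
        unfold wP wB
        field_simp; ring
      · intro x hx
        have e : -((p - β) / D β φ p) * φ 0 + (φ β - φ p) / D β φ p * x + (p - β) / D β φ p * φ x
          = ((p - β) * (φ x - φ 0) + x * (φ β - φ p)) / D β φ p := by field_simp; ring
        rw [e]
        apply div_nonneg _ hD.le
        rcases le_total x p with h | h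
        · have h3 := sc3le hconv le_rfl hx.1 h hpβ.le
          have h4 : 0 ≤ p * ((p - β) * (φ x - φ 0) + x * (φ β - φ p)) := by
            have e : p * ((p - β) * (φ x - φ 0) + x * (φ β - φ p)) = x * D β φ p +
              (β - p) * (φ 0 * (p - x) + φ p * (x - 0) - φ x * (p - 0)) := by
              rw [hDd]; ring
            rw [e]
            exact add_nonneg (mul_nonneg hx.1 hD.le) (mul_nonneg (by linarith) (by linarith))
          exact nonneg_of_mul_nonneg_right h4 hp0
        · have h3 := sc3le hconv hp0.le h hx.2 le_rfl
          linarith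
      · intro x hx h
        have e : -((p - β) / D β φ p) * φ 0 + (φ β - φ p) / D β φ p * x + (p - β) / D β φ p * φ x
          = ((p - β) * (φ x - φ 0) + x * (φ β - φ p)) / D β φ p := by field_simp; ring
        rw [e, le_div_iff₀ hD]
        have h3 := sc3le hconv hp0.le h hx.2 le_rfl
        linarith
  have B3 : ∀ p ∈ Icc τ₂ β,
      sSup ((fun P => tail P p) '' amb μ s β φ) = (μ - α p) / (p - α p) := by
    intro p hp
    obtain ⟨ha0, haμ⟩ := hαmem p hp
    have hA := Ha p hp
    have hap : α p < p := by linarith [hp.1]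
    generalize α p = a at *
    have hpa : 0 < p - a := by linarith
    have hpμ : μ < p := by linarith [hp.1]
    apply sup_eq
    · obtain ⟨P, hP, h⟩ := three_pt (μ := μ) (s := s) (β := β) (p := p) (φ := φ)
        ((p - μ) / (p - a)) ((μ - a) / (p - a)) 0 a p β
        (div_nonneg (by linarith) hpa.le) (div_nonneg (by linarith) hpa.le) le_rfl
        (by field_simp; ring) ⟨ha0, by linarith⟩ ⟨by linarith, hp.2⟩ ⟨hβ.le, le_rfl⟩
        (by field_simp; ring) (by field_simp; linarith) hap le_rfl hp.2
      exact ⟨P, hP, by simpa using h⟩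
    · intro P hP
      obtain ⟨m, hm⟩ := subgrad hconv hdiff (a := a) ⟨ha0, by linarith⟩
      have hK : 0 < φ p - φ a - m * (p - a) := by
        have h1 := sc3 hconv ha0 (y := (a + p) / 2) (z := p) (by linarith) (by linarith) hp.2
        have h2 := hm ((a + p) / 2) ⟨by linarith, by linarith [hp.2]⟩
        have h3 : 0 < (p - a) * (φ p - φ a - m * (p - a)) := by nlinarith
        exact pos_of_mul_pos_right h3 hpa.le
      set K := φ p - φ a - m * (p - a) with hKd
      have := upper_bd (p := p) hc hP ((-φ a + m * a) / K) (-m / K) (1 / K) ?_ ?_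
      · refine this.trans (le_of_eq ?_)
        have e : (-φ a + m * a) / K + -m / K * μ + 1 / K * s = (s - φ a - m * (μ - a)) / K := by
          field_simp; ring
        rw [e, div_eq_div_iff hK.ne' hpa.ne', hKd]
        linear_combination -hA
      · intro x hx
        have e : (-φ a + m * a) / K + -m / K * x + 1 / K * φ x = (φ x - φ a - m * (x - a)) / K := by
          field_simp; ring
        rw [e]
        exact div_nonneg (by linarith [hm x hx]) hK.le
      · intro x hx hpx
        have e : (-φ a + m * a) / K + -m / K * x + 1 / K * φ x = (φ x - φ a - m * (x - a)) / K := by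
          field_simp; ring
        rw [e, le_div_iff₀ hK, one_mul]
        have h := sc3le hconv ha0 hap.le hpx hx.2
        have h2 : K * (x - a) ≤ (φ x - φ a - m * (x - a)) * (p - a) := by
          rw [hKd]; linarith
        have h3 : K * (p - a) ≤ K * (x - a) := mul_le_mul_of_nonneg_left (by linarith) hK.le
        exact le_of_mul_le_mul_right (h3.trans h2) hpa
  refine ⟨B1, B2, B3, ?_⟩
  have C1 : ContinuousOn (fun p => sSup ((fun P => tail P p) '' amb μ s β φ)) (Ioc 0 τ₁) :=
    (continuousOn_const (c := (1:ℝ))).congr B1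
  have C2 : ContinuousOn (fun p => sSup ((fun P => tail P p) '' amb μ s β φ)) (Icc τ₁ τ₂) := by
    refine ContinuousOn.congr ?_ B2
    have hφ : ContinuousOn φ (Icc τ₁ τ₂) := hc.mono (Icc_subset_Icc hτ₁0 hτ₂β.le)
    have hDc : ContinuousOn (D β φ) (Icc τ₁ τ₂) := by unfold D; fun_prop
    have hDne : ∀ p ∈ Icc τ₁ τ₂, D β φ p ≠ 0 := fun p hp =>
      (hDpos p (by linarith [hp.1]) (by linarith [hp.2])).ne'
    unfold wP wB
    exact (continuousOn_const.div hDc hDne).add (ContinuousOn.div (by fun_prop) hDc hDne)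
  have Cα : ContinuousOn α (Icc τ₂ β) := by
    intro p hp
    have hFc : ∀ a, ContinuousWithinAt
        (fun q => s * (q - a) - φ a * (q - μ) - φ q * (μ - a)) (Icc τ₂ β) p := by
      intro a
      have : ContinuousWithinAt φ (Icc τ₂ β) p :=
        (hc.mono (Icc_subset_Icc hτ₂pos.le le_rfl)) p hp
      fun_prop
    have neg : ∀ q ∈ Icc τ₂ β, ∀ a, 0 ≤ a → a < α q →
        s * (q - a) - φ a * (q - μ) - φ q * (μ - a) < 0 := by
      intro q hq a ha h
      have hA := Ha q hq
      obtain ⟨-, h2⟩ := hαmem q hq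
      have h3 := sc3 hconv ha h h2 hμβ.le
      have hqμ : 0 < q - μ := by linarith [hq.1]
      have e : (μ - α q) * (s * (q - a) - φ a * (q - μ) - φ q * (μ - a)) =
        -((q - μ) * (φ a * (μ - α q) + φ μ * (α q - a) - φ (α q) * (μ - a)))
         - (q - μ) * (α q - a) * (s - φ μ) := by
        linear_combination (a - μ) * hA
      have h4 : 0 < (q - μ) * (φ a * (μ - α q) + φ μ * (α q - a) - φ (α q) * (μ - a)) :=
        mul_pos hqμ (by linarith)
      have h5 : 0 < (q - μ) * (α q - a) * (s - φ μ) :=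
        mul_pos (mul_pos hqμ (by linarith)) (by linarith)
      have h6 : 0 < μ - α q := by linarith
      by_contra! h7
      have := mul_nonneg h6.le h7
      linarith
    have pos : ∀ q ∈ Icc τ₂ β, ∀ a, α q < a → a < μ →
        0 < s * (q - a) - φ a * (q - μ) - φ q * (μ - a) := by
      intro q hq a h ha
      have hA := Ha q hq
      obtain ⟨h1, h2⟩ := hαmem q hq
      have h3 := sc3 hconv h1 h ha hμβ.le
      have hqμ : 0 < q - μ := by linarith [hq.1]
      have e : (μ - α q) * (s * (q - a) - φ a * (q - μ) - φ q * (μ - a)) =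
        (q - μ) * (φ (α q) * (μ - a) + φ μ * (a - α q) - φ a * (μ - α q))
         + (q - μ) * (a - α q) * (s - φ μ) := by
        linear_combination (a - μ) * hA
      have h4 : 0 < (q - μ) * (φ (α q) * (μ - a) + φ μ * (a - α q) - φ a * (μ - α q)) :=
        mul_pos hqμ (by linarith)
      have h5 : 0 < (q - μ) * (a - α q) * (s - φ μ) :=
        mul_pos (mul_pos hqμ (by linarith)) (by linarith)
      have h6 : 0 < μ - α q := by linarith
      have : 0 < (μ - α q) * (s * (q - a) - φ a * (q - μ) - φ q * (μ - a)) := by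
        rw [e]; linarith
      exact pos_of_mul_pos_right this h6.le
    refine tendsto_order.2 ⟨fun l hl => ?_, fun u hu => ?_⟩
    · rcases lt_or_ge l 0 with h | h
      · filter_upwards [self_mem_nhdsWithin] with q hq
        linarith [(hαmem q hq).1]
      · filter_upwards [self_mem_nhdsWithin,
          (hFc l).tendsto.eventually_lt_const (neg p hp l h hl)] with q hq hq2
        by_contra! h3
        rcases h3.eq_or_lt with h4 | h4
        · have := Ha q hq
          rw [h4] at this
          linarith
        · have := pos q hq l h4 (hl.trans (hαmem p hp).2)
          linarith
    · rcases le_or_gt μ u with h | h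
      · filter_upwards [self_mem_nhdsWithin] with q hq
        linarith [(hαmem q hq).2]
      · filter_upwards [self_mem_nhdsWithin,
          (hFc u).tendsto.eventually_const_lt (pos p hp u hu h)] with q hq hq2
        by_contra! h3
        rcases h3.eq_or_lt with h4 | h4
        · have := Ha q hq
          rw [← h4] at this
          linarith
        · have := neg q hq u ((hαmem p hp).1.trans hu.le) h4
          linarith
  have C3 : ContinuousOn (fun p => sSup ((fun P => tail P p) '' amb μ s β φ)) (Icc τ₂ β) := by
    refine ContinuousOn.congr ?_ B3
    refine (continuousOn_const.sub Cα).div (continuousOn_id.sub Cα) fun p hp => ?_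
    have := (hαmem p hp).2
    have := hp.1
    have h3 : 0 < p - α p := by linarith
    exact h3.ne'
  generalize (fun p => sSup ((fun P => tail P p) '' amb μ s β φ)) = V at C1 C2 C3 ⊢
  have C23 : ContinuousOn V (Icc τ₁ β) := by
    rw [← Icc_union_Icc_eq_Icc (b := τ₂) (by linarith) hτ₂β.le]
    exact C2.union_of_isClosed C3 isClosed_Icc isClosed_Icc
  intro p hp
  have hsub : Ioc 0 β ⊆ Ioc 0 τ₁ ∪ Icc τ₁ β := by
    intro x hx
    rcases le_total x τ₁ with h | h
    · exact Or.inl ⟨hx.1, h⟩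
    · exact Or.inr ⟨h, hx.2⟩
  refine ContinuousWithinAt.mono ?_ hsub
  refine ContinuousWithinAt.union ?_ ?_
  · rcases le_or_gt p τ₁ with h | h
    · exact C1 p ⟨hp.1, h⟩
    · apply continuousWithinAt_of_notMem_closure
      intro h2
      have := closure_minimal (Ioc_subset_Icc_self) isClosed_Icc h2
      linarith [this.2]
  · rcases lt_or_ge p τ₁ with h | h
    · apply continuousWithinAt_of_notMem_closure
      rw [isClosed_Icc.closure_eq]
      intro h2
      linarith [h2.1]
    · exact C23 p ⟨h, hp.2⟩
end

section
/- Monotonicity of the best-case revenue function: Fix 0 < μ, β > 0, s > 0 and a strictly convex differentiable dispersion function φ : [0,β] → ℝ≥0, assume μ ≤ τ₂ < β. Then the function g(p) = p · sup_{P ∈ 𝒫(μ,s,β,φ)} P(X ≥ p) is non-decreasing on the interval (0, τ₂]. -/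
open MeasureTheory Set

lemma three_point (μ s β : ℝ) (φ : ℝ → ℝ) (a b c x y z : ℝ) (ha : 0 ≤ a) (hb : 0 ≤ b) (hc : 0 ≤ c)
    (hsum : a + b + c = 1) (hx : x ∈ Icc 0 β) (hy : y ∈ Icc 0 β) (hz : z ∈ Icc 0 β)
    (hm : a * x + b * y + c * z = μ) (hd : a * φ x + b * φ y + c * φ z = s) :
    ∃ P ∈ amb μ s β φ, ∀ p, p ≤ y → p ≤ z → b + c ≤ tail P p ∧ (p ≤ x → 1 ≤ tail P p) := by
  have hint : ∀ f : ℝ → ℝ, ∫ t, f t ∂(ENNReal.ofReal a • Measure.dirac x + ENNReal.ofReal b • Measure.dirac y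
      + ENNReal.ofReal c • Measure.dirac z) = a * f x + b * f y + c * f z := by
    intro f
    have hi : ∀ (w t : ℝ), Integrable f (ENNReal.ofReal w • Measure.dirac t) := fun w t =>
      (integrable_dirac (by simp)).smul_measure ENNReal.ofReal_ne_top
    rw [integral_add_measure ((hi _ _).add_measure (hi _ _)) (hi _ _),
      integral_add_measure (hi _ _) (hi _ _)]
    simp [integral_smul_measure, ha, hb, hc]
  have hset : ∀ S : Set ℝ, MeasurableSet S → (ENNReal.ofReal a • Measure.dirac x + ENNReal.ofReal b • Measure.dirac y
      + ENNReal.ofReal c • Measure.dirac z) S = ENNReal.ofReal (a * S.indicator 1 x + b * S.indicator 1 y + c * S.indicator 1 z) := by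
    intro S hS
    have h1 : ∀ t, 0 ≤ S.indicator (1 : ℝ → ℝ) t := fun t => indicator_nonneg (by simp) t
    rw [ENNReal.ofReal_add (by have := h1 x; have := h1 y; positivity) (mul_nonneg hc (h1 z)),
      ENNReal.ofReal_add (mul_nonneg ha (h1 x)) (mul_nonneg hb (h1 y))]
    have h2 : ∀ w t : ℝ, ENNReal.ofReal (w * S.indicator 1 t) = ENNReal.ofReal w * S.indicator 1 t := by
      intro w t
      by_cases h : t ∈ S <;> simp [h]
    simp [h2, hS]
  refine ⟨_, ⟨⟨?_⟩, ?_, (hint _).trans hm, (hint _).trans hd⟩, ?_⟩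
  · rw [hset _ MeasurableSet.univ]; simp [hsum]
  · rw [hset _ measurableSet_Icc]; simp only [indicator_of_mem hx, indicator_of_mem hy, indicator_of_mem hz]; simp [hsum]
  · intro p hpy hpz
    have h1 : 0 ≤ (Ici p).indicator (1 : ℝ → ℝ) x := indicator_nonneg (by simp) x
    have hy' : y ∈ Ici p := hpy
    have hz' : z ∈ Ici p := hpz
    unfold tail
    rw [hset _ measurableSet_Ici, indicator_of_mem hy', indicator_of_mem hz']
    simp only [Pi.one_apply, mul_one]
    have := mul_nonneg ha h1
    rw [ENNReal.toReal_ofReal (by linarith)]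
    refine ⟨by linarith, fun hpx => ?_⟩
    have hx' : x ∈ Ici p := hpx
    rw [indicator_of_mem hx']
    simp only [Pi.one_apply, mul_one]
    linarith

lemma tail_le_one_s10 (P : Measure ℝ) (h : IsProbabilityMeasure P) (p : ℝ) : tail P p ≤ 1 :=
  measureReal_le_one

lemma upper (μ β s c : ℝ) (φ : ℝ → ℝ) (hcont : ContinuousOn φ (Icc 0 β)) (hβ : 0 < β)
    (ψ : ℝ → ℝ) (hψ : ∀ x, ψ x = φ x - φ 0 - c * x) (hs : s - φ 0 = c * μ)
    (hconv : ConvexOn ℝ (Icc 0 β) ψ) (hD : 0 < ψ β)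
    (p : ℝ) (hp : 0 < p) (hpβ : p < β) (hu : ψ p ≤ 0) (P : Measure ℝ) (hP : P ∈ amb μ s β φ) :
    tail P p ≤ μ * (ψ β - ψ p) / (p * ψ β - β * ψ p) := by
  obtain ⟨hprob, hsupp, hm, hd⟩ := hP
  have hden : 0 < p * ψ β - β * ψ p := by nlinarith [mul_pos hp hD]
  have h0 : ψ 0 = 0 := by rw [hψ]; ring
  have hae : ∀ᵐ x ∂P, x ∈ Icc 0 β := by
    rw [← prob_compl_eq_zero_iff measurableSet_Icc] at hsupp
    exact hsupp
  have hres : P.restrict (Icc 0 β) = P := Measure.restrict_eq_self_of_ae_mem hae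
  have hI : ∀ f : ℝ → ℝ, ContinuousOn f (Icc 0 β) → Integrable f P := by
    intro f hf
    have := hf.integrableOn_compact (μ := P) isCompact_Icc
    rwa [IntegrableOn, hres] at this
  have hIφ := hI φ hcont
  have hIx := hI (fun x => x) continuousOn_id
  have hIψ : Integrable ψ P := by
    rw [funext hψ]
    exact (hIφ.sub (integrable_const _)).sub (hIx.const_mul c)
  have hiψ : ∫ x, ψ x ∂P = 0 := by
    simp_rw [hψ]
    rw [integral_sub (f := fun x => φ x - φ 0) (hIφ.sub (integrable_const _)) (hIx.const_mul c),
      integral_sub hIφ (integrable_const _), integral_const_mul, hm, hd]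
    simp
    linarith
  set E := p * ψ β - β * ψ p with hE
  -- the dual function
  have key : ∀ x ∈ Icc 0 β, (Ici p).indicator (fun _ => (1:ℝ)) x ≤
      (ψ β - ψ p) / E * x + -((β - p) / E) * ψ x := by
    intro x hx
    have e : (ψ β - ψ p) / E * x + -((β - p) / E) * ψ x
        = ((ψ β - ψ p) * x - (β - p) * ψ x) / E := by ring
    rw [e]
    by_cases hxp : p ≤ x
    · have hxp' : x ∈ Ici p := hxp
      rw [indicator_of_mem hxp', le_div_iff₀ hden, hE]
      -- ψ x ≤ chord
      have cv := hconv.2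
      have := cv (x := p) ⟨hp.le, hpβ.le⟩ (y := β) ⟨hβ.le, le_rfl⟩
        (a := (β - x) / (β - p)) (b := (x - p) / (β - p))
        (div_nonneg (by linarith [hx.2]) (by linarith)) (div_nonneg (by linarith) (by linarith))
        (by rw [← add_div, div_eq_one_iff_eq (by linarith)]; ring)
      have hpt : (β - x) / (β - p) * p + (x - p) / (β - p) * β = x := by
        have : β - p ≠ 0 := by linarith
        field_simp
        ring
      simp only [smul_eq_mul] at this
      rw [hpt, div_mul_eq_mul_div, div_mul_eq_mul_div, ← add_div, le_div_iff₀ (by linarith)] at this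
      nlinarith
    · have hxp' : x ∉ Ici p := hxp
      rw [indicator_of_notMem hxp']
      apply div_nonneg _ hden.le
      push Not at hxp
      have cv := hconv.2
      have := cv (x := 0) ⟨le_rfl, hβ.le⟩ (y := p) ⟨hp.le, hpβ.le⟩
        (a := (p - x) / p) (b := x / p)
        (div_nonneg (by linarith) hp.le) (div_nonneg hx.1 hp.le)
        (by rw [← add_div, div_eq_one_iff_eq hp.ne']; ring)
      have hpt : (p - x) / p * 0 + x / p * p = x := by
        field_simp
        ring
      simp only [smul_eq_mul] at this
      rw [hpt, h0, mul_zero, zero_add] at this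
      have h2 : ψ x ≤ 0 := this.trans (mul_nonpos_of_nonneg_of_nonpos (div_nonneg hx.1 hp.le) hu)
      have h3 : 0 ≤ (ψ β - ψ p) * x := mul_nonneg (by linarith) hx.1
      nlinarith
  have h1 : ∫ x, (Ici p).indicator (fun _ => (1:ℝ)) x ∂P = tail P p := by
    rw [integral_indicator measurableSet_Ici]
    simp [tail, measureReal_def]
  rw [← h1]
  calc _ ≤ ∫ x, ((ψ β - ψ p) / E * x + -((β - p) / E) * ψ x) ∂P := by
        apply integral_mono_ae ((integrable_const _).indicator measurableSet_Ici)
          ((hIx.const_mul _).add (hIψ.const_mul _))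
        filter_upwards [hae] with x hx using key x hx
    _ = _ := by
        rw [integral_add (hIx.const_mul _) (hIψ.const_mul _), integral_const_mul,
          integral_const_mul, hm, hiψ]
        ring

lemma lower_s10 (μ β s c : ℝ) (φ : ℝ → ℝ) (hβ : 0 < β) (hμ : 0 < μ) (hμβ : μ < β)
    (ψ : ℝ → ℝ) (hψ : ∀ x, ψ x = φ x - φ 0 - c * x) (hs : s - φ 0 = c * μ)
    (hD : 0 < ψ β) (hψμ : ψ μ ≤ 0)
    (q : ℝ) (hq : 0 < q) (hqβ : q < β) (hv : ψ q ≤ 0) :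
    ∃ P ∈ amb μ s β φ, min 1 (μ * (ψ β - ψ q) / (q * ψ β - β * ψ q)) ≤ tail P q := by
  have hden : 0 < q * ψ β - β * ψ q := by nlinarith [mul_pos hq hD]
  set E := q * ψ β - β * ψ q with hE
  have h0 : ψ 0 = 0 := by rw [hψ]; ring
  have hcv : ∀ a b d x y z : ℝ, a + b + d = 1 → a * x + b * y + d * z = μ →
      a * ψ x + b * ψ y + d * ψ z = 0 → a * φ x + b * φ y + d * φ z = s := by
    intro a b d x y z h1 h2 h3
    rw [hψ, hψ, hψ] at h3
    linear_combination h3 + φ 0 * h1 + c * h2 - hs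
  by_cases hle : μ * (ψ β - ψ q) / E ≤ 1
  · have hsum : (1 - μ * (ψ β - ψ q) / E) + μ * ψ β / E + μ * (-ψ q) / E = 1 := by ring
    have hm : (1 - μ * (ψ β - ψ q) / E) * 0 + μ * ψ β / E * q + μ * (-ψ q) / E * β = μ := by
      field_simp
      rw [hE]; ring
    obtain ⟨P, hP, hP'⟩ := three_point μ s β φ (1 - μ * (ψ β - ψ q) / E) (μ * ψ β / E)
      (μ * (- ψ q) / E) 0 q β (by linarith) (by positivity)
      (div_nonneg (mul_nonneg hμ.le (by linarith)) hden.le) hsum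
      ⟨le_rfl, hβ.le⟩ ⟨hq.le, hqβ.le⟩ ⟨hβ.le, le_rfl⟩ hm
      (hcv _ _ _ _ _ _ hsum hm (by rw [h0]; ring))
    refine ⟨P, hP, (min_le_right _ _).trans ((hP' q le_rfl hqβ.le).1.trans' (le_of_eq ?_))⟩
    ring
  · push Not at hle
    rw [lt_div_iff₀ hden, hE] at hle
    have hqμ : q < μ := by
      by_contra hcon
      push Not at hcon
      nlinarith [mul_nonneg (sub_nonneg.2 hcon) hD.le, mul_nonneg (sub_nonneg.2 hμβ.le) (neg_nonneg.2 hv)]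
    -- F = integral of ψ (times (β - q)) under the two-point law on q, β
    set F := (β - μ) * ψ q + (μ - q) * ψ β with hF
    have hFpos : 0 < F := by rw [hF]; nlinarith
    set G := F - (β - q) * ψ μ with hG
    have hGpos : 0 < G := by
      have := mul_nonneg (sub_nonneg.2 hqβ.le) (neg_nonneg.2 hψμ)
      rw [hG]; nlinarith
    -- weight on μ: F/G ; on q: (-ψ μ)(β-μ)/G ; on β: (-ψ μ)(μ-q)/G
    have hsum : F / G + (-ψ μ) * (β - μ) / G + (-ψ μ) * (μ - q) / G = 1 := by
      field_simp
      rw [hG]; ring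
    have hm : F / G * μ + (-ψ μ) * (β - μ) / G * q + (-ψ μ) * (μ - q) / G * β = μ := by
      field_simp
      rw [hG]; ring
    obtain ⟨P, hP, hP'⟩ := three_point μ s β φ (F / G) ((-ψ μ) * (β - μ) / G)
      ((-ψ μ) * (μ - q) / G) μ q β (by positivity)
      (div_nonneg (mul_nonneg (by linarith) (by linarith)) hGpos.le)
      (div_nonneg (mul_nonneg (by linarith) (by linarith)) hGpos.le) hsum
      ⟨hμ.le, hμβ.le⟩ ⟨hq.le, hqβ.le⟩ ⟨hβ.le, le_rfl⟩ hm
      (hcv _ _ _ _ _ _ hsum hm (by field_simp; rw [hF]; ring))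
    exact ⟨P, hP, (min_le_left _ _).trans ((hP' q le_rfl hqβ.le).2 hqμ.le)⟩

/-- **Monotonicity of the best-case revenue function** (Lemma 4): the function
`g(p) = p · sup_{P ∈ 𝒫(μ,s,β,φ)} P(X ≥ p)` is non-decreasing on `(0,τ₂]`. -/
theorem best_case_revenue_monotone
    (μ β s τ₂ : ℝ) (φ : ℝ → ℝ)
    (hμ : 0 < μ) (hβ : 0 < β) (hs : 0 < s)
    (hconv : StrictConvexOn ℝ (Icc 0 β) φ)
    (hdiff : DifferentiableOn ℝ φ (Icc 0 β))
    (hnonneg : ∀ x ∈ Icc (0:ℝ) β, 0 ≤ φ x)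
    (hτ₂pos : 0 < τ₂)
    (hτ₂eq : (s - φ 0) / μ = (φ τ₂ - φ 0) / τ₂)
    (hμτ : μ ≤ τ₂) (hτβ : τ₂ < β) :
    MonotoneOn (fun p => p * sSup ((fun P => tail P p) '' amb μ s β φ)) (Ioc 0 τ₂) := by
  obtain ⟨c, hc⟩ : ∃ c, c = (φ τ₂ - φ 0) / τ₂ := ⟨_, rfl⟩
  obtain ⟨ψ, hψ⟩ : ∃ ψ : ℝ → ℝ, ∀ x, ψ x = φ x - φ 0 - c * x := ⟨_, fun _ => rfl⟩
  have hs' : s - φ 0 = c * μ := by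
    rw [← hc, div_eq_iff hμ.ne'] at hτ₂eq
    exact hτ₂eq
  have h0 : ψ 0 = 0 := by rw [hψ]; ring
  have hτ : ψ τ₂ = 0 := by rw [hψ, hc]; field_simp; ring
  have hsc : StrictConvexOn ℝ (Icc 0 β) ψ := by
    refine ⟨hconv.1, fun x hx y hy hxy a b ha hb hab => ?_⟩
    have := hconv.2 hx hy hxy ha hb hab
    simp only [smul_eq_mul, hψ] at this ⊢
    have hb' : b = 1 - a := by linarith
    subst hb'
    linarith
  -- scaling: ψ (t) * r ≤ ψ r * t for 0 ≤ t ≤ r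
  have hslope : ∀ t r, 0 < t → t < r → r ≤ β → ψ t * r < ψ r * t := by
    intro t r ht htr hr
    have hr0 : 0 < r := ht.trans htr
    have cv := hsc.2
    have := cv (x := 0) ⟨le_rfl, hβ.le⟩ (y := r) ⟨hr0.le, hr⟩ hr0.ne
      (a := (r - t) / r) (b := t / r) (div_pos (by linarith) hr0) (div_pos ht hr0)
      (by rw [← add_div, div_eq_one_iff_eq hr0.ne']; ring)
    have hpt : (r - t) / r * 0 + t / r * r = t := by
      field_simp
      ring
    simp only [smul_eq_mul] at this
    rw [hpt, h0, mul_zero, zero_add, div_mul_eq_mul_div, lt_div_iff₀ hr0] at this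
    linarith
  have hD : 0 < ψ β := by
    have := hslope τ₂ β hτ₂pos hτβ le_rfl
    rw [hτ, zero_mul] at this
    exact pos_of_mul_pos_left this hτ₂pos.le
  have hneg : ∀ t, 0 < t → t ≤ τ₂ → ψ t ≤ 0 := by
    intro t ht htτ
    rcases htτ.eq_or_lt with rfl | h
    · exact hτ.le
    · have := hslope t τ₂ ht h hτβ.le
      rw [hτ, zero_mul] at this
      nlinarith
  intro p hp q hq hpq
  rcases hpq.eq_or_lt with rfl | hlt
  · exact le_rfl
  have hpβ : p < β := hp.2.trans_lt hτβ
  have hqβ : q < β := hq.2.trans_lt hτβ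
  have hu := hneg p hp.1 hp.2
  have hv := hneg q hq.1 hq.2
  have hEp : 0 < p * ψ β - β * ψ p := by nlinarith [mul_pos hp.1 hD]
  have hEq : 0 < q * ψ β - β * ψ q := by nlinarith [mul_pos hq.1 hD]
  have hup : sSup ((fun P => tail P p) '' amb μ s β φ) ≤
      min 1 (μ * (ψ β - ψ p) / (p * ψ β - β * ψ p)) := by
    apply Real.sSup_le
    · rintro _ ⟨P, hP, rfl⟩
      exact le_min (tail_le_one_s10 P hP.1 p)
        (upper μ β s c φ hdiff.continuousOn hβ ψ hψ hs' hsc.convexOn hD p hp.1 hpβ hu P hP)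
    · exact le_min zero_le_one (div_nonneg (mul_nonneg hμ.le (by linarith)) hEp.le)
  have hlow : min 1 (μ * (ψ β - ψ q) / (q * ψ β - β * ψ q)) ≤
      sSup ((fun P => tail P q) '' amb μ s β φ) := by
    obtain ⟨P, hP, h⟩ := lower_s10 μ β s c φ hβ hμ (hμτ.trans_lt hτβ) ψ hψ hs' hD (hneg μ hμ hμτ)
      q hq.1 hqβ hv
    refine h.trans (le_csSup ⟨1, ?_⟩ ⟨P, hP, rfl⟩)
    rintro _ ⟨P, hP, rfl⟩
    exact tail_le_one_s10 P hP.1 q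
  have hmid : p * (μ * (ψ β - ψ p) / (p * ψ β - β * ψ p)) ≤
      q * (μ * (ψ β - ψ q) / (q * ψ β - β * ψ q)) := by
    rw [← mul_div_assoc, ← mul_div_assoc, div_le_div_iff₀ hEp hEq]
    have hsl := hslope p q hp.1 hlt hqβ.le
    obtain ⟨u, hu'⟩ : ∃ u, u = -ψ p := ⟨_, rfl⟩
    obtain ⟨v, hv'⟩ : ∃ v, v = -ψ q := ⟨_, rfl⟩
    have e1 : ψ p = -u := by linarith
    have e2 : ψ q = -v := by linarith
    rw [e1] at hu hsl ⊢
    rw [e2] at hv hsl ⊢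
    have hu0 : 0 ≤ u := by linarith
    have hv0 : 0 ≤ v := by linarith
    have a1 : 0 ≤ q * u - p * v := by linarith
    have a2 : 0 ≤ (β - p) * (q * u - p * v) := mul_nonneg (by linarith) a1
    have a3 : 0 ≤ p * (v * (q - p)) := mul_nonneg hp.1.le (mul_nonneg hv0 (by linarith))
    have a4 : 0 ≤ β * (u * v) * (q - p) :=
      mul_nonneg (mul_nonneg hβ.le (mul_nonneg hu0 hv0)) (by linarith)
    have a5 : 0 ≤ ψ β * ((β - p) * (q * u - p * v) + p * (v * (q - p))) :=
      mul_nonneg hD.le (add_nonneg a2 a3)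
    have a6 := mul_nonneg hμ.le (add_nonneg a5 a4)
    linarith
  calc p * sSup ((fun P => tail P p) '' amb μ s β φ)
      ≤ p * min 1 (μ * (ψ β - ψ p) / (p * ψ β - β * ψ p)) :=
        mul_le_mul_of_nonneg_left hup hp.1.le
    _ ≤ q * min 1 (μ * (ψ β - ψ q) / (q * ψ β - β * ψ q)) := by
        rw [mul_min_of_nonneg _ _ hp.1.le, mul_min_of_nonneg _ _ hq.1.le]
        exact min_le_min (by linarith) hmid
    _ ≤ _ := mul_le_mul_of_nonneg_left hlow hq.1.le
end

section
/- Ordering of robust high prices: Let β and τ₂ be real numbers with 0 < τ₂ < β. Then both high-price candidates for the competitive-ratio objective lie strictly below the maximin-revenue high price: (β + τ₂ − √((3β − τ₂)² − 4β²))/2 < β − √(β(β − τ₂)) and τ₂/2 < β − √(β(β − τ₂)); equivalently, max{(β + τ₂ − √((3β − τ₂)² − 4β²))/2, τ₂/2} < β − √(β(β − τ₂)). -/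
/-- **Ordering of robust high prices** (Theorem 4, high-price part): for `0 < τ₂ < β`
both competitive-ratio high-price candidates lie strictly below the maximin-revenue
high price `β − √(β(β−τ₂))`. -/
theorem high_price_ordering (β τ₂ : ℝ) (hτ : 0 < τ₂) (hτβ : τ₂ < β) :
    (β + τ₂ - Real.sqrt ((3 * β - τ₂) ^ 2 - 4 * β ^ 2)) / 2
        < β - Real.sqrt (β * (β - τ₂)) ∧
    τ₂ / 2 < β - Real.sqrt (β * (β - τ₂)) ∧
    max ((β + τ₂ - Real.sqrt ((3 * β - τ₂) ^ 2 - 4 * β ^ 2)) / 2) (τ₂ / 2)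
        < β - Real.sqrt (β * (β - τ₂)) := by
  have hd : 0 < β - τ₂ := by linarith
  have hβ : 0 < β := by linarith
  have h2 : Real.sqrt (β * (β - τ₂)) < β - τ₂ / 2 := by
    rw [Real.sqrt_lt' (by linarith)]
    nlinarith [mul_pos hτ hτ]
  have h1 : 2 * Real.sqrt (β * (β - τ₂)) ≤ Real.sqrt ((3 * β - τ₂) ^ 2 - 4 * β ^ 2) := by
    apply Real.le_sqrt_of_sq_le
    rw [mul_pow, Real.sq_sqrt (mul_pos hβ hd).le]
    nlinarith [mul_pos hd hd]
  have a : (β + τ₂ - Real.sqrt ((3 * β - τ₂) ^ 2 - 4 * β ^ 2)) / 2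
      < β - Real.sqrt (β * (β - τ₂)) := by linarith
  have b : τ₂ / 2 < β - Real.sqrt (β * (β - τ₂)) := by linarith
  exact ⟨a, b, max_lt a b⟩
end

section
/- Key convexity inequality for the best-case revenue function: Let β > 0, let φ : [0,β] → ℝ be convex and differentiable, and let p, τ₂ be reals with 0 < p ≤ τ₂ ≤ β and p < β. Then β p² · ( (φ(β) − φ(0))/β − (φ(p) − φ(0))/p ) · ( (φ(τ₂) − φ(0))/τ₂ − φ'(p) ) + β p (β − p) · ( φ'(p) − (φ(p) − φ(0))/p ) · ( (φ(β) − φ(p))/(β − p) − (φ(τ₂) − φ(0))/τ₂ ) ≥ 0. -/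
open Set

/-- **Key convexity inequality for the best-case revenue function** (core estimate of
Lemma 4): for a convex differentiable `φ` on `[0,β]` and `0 < p ≤ τ₂ ≤ β`, `p < β`. -/
theorem key_convexity_inequality
    (β p τ₂ : ℝ) (φ : ℝ → ℝ)
    (hβ : 0 < β)
    (hconv : ConvexOn ℝ (Icc 0 β) φ)
    (hdiff : DifferentiableOn ℝ φ (Icc 0 β))
    (hp : 0 < p) (hpτ : p ≤ τ₂) (hτβ : τ₂ ≤ β) (hpβ : p < β) :
    0 ≤ β * p ^ 2 * ((φ β - φ 0) / β - (φ p - φ 0) / p) *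
          ((φ τ₂ - φ 0) / τ₂ - deriv φ p)
        + β * p * (β - p) * (deriv φ p - (φ p - φ 0) / p) *
          ((φ β - φ p) / (β - p) - (φ τ₂ - φ 0) / τ₂) := by
  have m0 : (0:ℝ) ∈ Icc 0 β := ⟨le_rfl, hβ.le⟩
  have mp : p ∈ Icc 0 β := ⟨hp.le, hpβ.le⟩
  have mt : τ₂ ∈ Icc 0 β := ⟨hp.le.trans hpτ, hτβ⟩
  have mb : β ∈ Icc 0 β := ⟨hβ.le, le_rfl⟩
  have ht : 0 < τ₂ := hp.trans_le hpτ
  have hd : DifferentiableAt ℝ φ p := hdiff.differentiableAt (Icc_mem_nhds hp hpβ)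
  have h1 := hconv.slope_le_deriv m0 mp hp hd
  have h2 := hconv.secant_mono m0 mp mt hp.ne' ht.ne' hpτ
  have h3 := hconv.secant_mono m0 mt mb ht.ne' hβ.ne' hτβ
  rw [slope_def_field] at h1
  simp only [sub_zero] at h1 h2 h3
  have hbp : 0 < β - p := sub_pos.2 hpβ
  have e : (φ β - φ p) / (β - p)
      = (β * ((φ β - φ 0) / β) - p * ((φ p - φ 0) / p)) / (β - p) := by
    field_simp
    ring
  rw [e]
  generalize (φ β - φ 0) / β = S at *
  generalize (φ p - φ 0) / p = a at *
  generalize (φ τ₂ - φ 0) / τ₂ = s at *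
  generalize deriv φ p = d at *
  have e2 : β * p ^ 2 * (S - a) * (s - d) + β * p * (β - p) * (d - a) *
      ((β * S - p * a) / (β - p) - s)
      = β * p * (p * ((S - a) * (s - a)) + (β - p) * ((d - a) * (S - s))) := by
    field_simp
    ring
  rw [e2]
  have := mul_nonneg (sub_nonneg.2 (h2.trans h3)) (sub_nonneg.2 h2)
  have := mul_nonneg (sub_nonneg.2 h1) (sub_nonneg.2 h3)
  positivity
end

section
/- Unimodality of the worst-case ratio branch for power dispersion: Let q > 1, μ > 0, s > 0, set τ₂ = (s/μ)^{1/(q−1)}, and let β > τ₂. Define g_{2a}(p) = (p s − μ p^q) / ( μ(β^q − p^q) − s(β − p) ) for p ∈ (0, τ₂], and set p̂ = (s/(qμ))^{1/(q−1)} (note 0 < p̂ < τ₂). Then the denominator μ(β^q − p^q) − s(β − p) is strictly positive for all p ∈ (0,τ₂], g_{2a} is monotonically increasing on (0, p̂] and monotonically decreasing on [p̂, τ₂]; in particular g_{2a} has a unique local maximum location on (0,τ₂], attained at p̂. -/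
open Set

/-- The middle branch `g_{2a}(p) = (ps − μp^q)/(μ(β^q − p^q) − s(β − p))` of the
worst-case competitive ratio for power dispersion `φ(x) = x^q`. -/
noncomputable def g2a (q μ s β : ℝ) (p : ℝ) : ℝ :=
  (p * s - μ * p ^ q) / (μ * (β ^ q - p ^ q) - s * (β - p))

lemma aux_root {c q : ℝ} (hq : 1 < q) (hc : 0 < c) : (c ^ (1 / (q - 1))) ^ (q - 1) = c := by
  rw [← Real.rpow_mul hc.le, one_div_mul_cancel (by linarith), Real.rpow_one]

lemma aux_pow {p q : ℝ} (hp : 0 < p) : p ^ q = p ^ (q - 1) * p := by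
  rw [Real.rpow_sub_one hp.ne', div_mul_cancel₀ _ hp.ne']

lemma aux_deriv (q μ s : ℝ) {p : ℝ} (hp : 0 < p) :
    HasDerivAt (fun p : ℝ => p * s - μ * p ^ q) (s - μ * (q * p ^ (q - 1))) p := by
  have h1 := (hasDerivAt_id p).mul_const s
  have h2 := (Real.hasDerivAt_rpow_const (p := q) (Or.inl hp.ne')).const_mul μ
  have h3 := h1.sub h2
  rw [one_mul] at h3
  exact h3

lemma aux_frac {a b C : ℝ} (hC : 0 < C) (ha : 0 ≤ a) (hab : a < b) :
    a / (C + a) < b / (C + b) := by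
  rw [div_lt_div_iff₀ (by linarith) (by linarith)]
  nlinarith

/-- **Unimodality of the worst-case ratio branch for power dispersion** (Lemma 5, second
part): with `τ₂ = (s/μ)^{1/(q−1)}`, `β > τ₂` and `p̂ = (s/(qμ))^{1/(q−1)}`, the
denominator of `g_{2a}` is strictly positive on `(0,τ₂]`, `0 < p̂ < τ₂`, and `g_{2a}` is
increasing on `(0,p̂]` and decreasing on `[p̂,τ₂]`; in particular `p̂` is the unique
local maximum location of `g_{2a}` on `(0,τ₂]`. -/
theorem g2a_unimodal
    (q μ s β : ℝ) (hq : 1 < q) (hμ : 0 < μ) (hs : 0 < s)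
    (hβ : (s / μ) ^ (1 / (q - 1)) < β) :
    0 < (s / (q * μ)) ^ (1 / (q - 1)) ∧
    (s / (q * μ)) ^ (1 / (q - 1)) < (s / μ) ^ (1 / (q - 1)) ∧
    (∀ p ∈ Ioc (0:ℝ) ((s / μ) ^ (1 / (q - 1))),
        0 < μ * (β ^ q - p ^ q) - s * (β - p)) ∧
    StrictMonoOn (g2a q μ s β) (Ioc (0:ℝ) ((s / (q * μ)) ^ (1 / (q - 1)))) ∧
    StrictAntiOn (g2a q μ s β) (Icc ((s / (q * μ)) ^ (1 / (q - 1))) ((s / μ) ^ (1 / (q - 1)))) ∧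
    (∀ p ∈ Ioc (0:ℝ) ((s / μ) ^ (1 / (q - 1))),
        p ≠ (s / (q * μ)) ^ (1 / (q - 1)) →
        g2a q μ s β p < g2a q μ s β ((s / (q * μ)) ^ (1 / (q - 1)))) := by
  have hq1 : 0 < q - 1 := by linarith
  have hq0 : 0 < q := by linarith
  have hc1 : 0 < s / (q * μ) := by positivity
  have hc2 : 0 < s / μ := by positivity
  have e1 := aux_root hq hc1
  have e2 := aux_root hq hc2
  have hlt : (s / (q * μ)) ^ (1 / (q - 1)) < (s / μ) ^ (1 / (q - 1)) := by
    apply Real.rpow_lt_rpow hc1.le _ (by positivity)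
    apply div_lt_div_of_pos_left hs hμ
    nlinarith
  have ht : 0 < (s / (q * μ)) ^ (1 / (q - 1)) := by positivity
  generalize (s / (q * μ)) ^ (1 / (q - 1)) = t at *
  generalize (s / μ) ^ (1 / (q - 1)) = T at *
  have e1' : μ * (q * t ^ (q - 1)) = s := by rw [e1]; field_simp
  have e2' : μ * T ^ (q - 1) = s := by rw [e2]; field_simp
  have hT : 0 < T := ht.trans hlt
  have hβ0 : 0 < β := hT.trans hβ
  have hC : 0 < μ * β ^ q - s * β := by
    rw [aux_pow hβ0]
    have h := Real.rpow_lt_rpow hT.le hβ hq1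
    have h2 := mul_lt_mul_of_pos_left h hμ
    rw [e2'] at h2
    have h3 := mul_lt_mul_of_pos_right h2 hβ0
    linarith
  have hN : ∀ p ∈ Ioc (0:ℝ) T, 0 ≤ p * s - μ * p ^ q := by
    intro p hp
    rw [aux_pow hp.1]
    have h := Real.rpow_le_rpow hp.1.le hp.2 hq1.le
    have h2 := mul_le_mul_of_nonneg_left h hμ.le
    rw [e2'] at h2
    have h3 := mul_le_mul_of_nonneg_right h2 hp.1.le
    linarith
  have hg : ∀ p, g2a q μ s β p
      = (p * s - μ * p ^ q) / ((μ * β ^ q - s * β) + (p * s - μ * p ^ q)) := by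
    intro p
    unfold g2a
    congr 1
    ring
  have hmono : StrictMonoOn (fun p : ℝ => p * s - μ * p ^ q) (Ioc 0 t) := by
    apply strictMonoOn_of_deriv_pos (convex_Ioc 0 t)
    · intro p hp
      exact (aux_deriv q μ s hp.1).continuousAt.continuousWithinAt
    · intro p hp
      rw [interior_Ioc] at hp
      rw [(aux_deriv q μ s hp.1).deriv]
      have h := Real.rpow_lt_rpow hp.1.le hp.2 hq1
      have h2 := mul_lt_mul_of_pos_left (mul_lt_mul_of_pos_left h hq0) hμ
      linarith
  have hanti : StrictAntiOn (fun p : ℝ => p * s - μ * p ^ q) (Icc t T) := by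
    apply strictAntiOn_of_deriv_neg (convex_Icc t T)
    · intro p hp
      exact (aux_deriv q μ s (ht.trans_le hp.1)).continuousAt.continuousWithinAt
    · intro p hp
      rw [interior_Icc] at hp
      rw [(aux_deriv q μ s (ht.trans hp.1)).deriv]
      have h := Real.rpow_lt_rpow ht.le hp.1 hq1
      have h2 := mul_lt_mul_of_pos_left (mul_lt_mul_of_pos_left h hq0) hμ
      linarith
  have hM : StrictMonoOn (g2a q μ s β) (Ioc (0:ℝ) t) := by
    intro a ha b hb hab
    rw [hg, hg]
    exact aux_frac hC (hN a ⟨ha.1, ha.2.trans hlt.le⟩) (hmono ha hb hab)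
  have hA : StrictAntiOn (g2a q μ s β) (Icc t T) := by
    intro a ha b hb hab
    rw [hg, hg]
    exact aux_frac hC (hN b ⟨ht.trans_le hb.1, hb.2⟩) (hanti ha hb hab)
  refine ⟨ht, hlt, ?_, hM, hA, ?_⟩
  · intro p hp
    have := hN p hp
    linarith
  · intro p hp hne
    rcases lt_or_gt_of_ne hne with h | h
    · exact hM ⟨hp.1, h.le⟩ ⟨ht, le_rfl⟩ h
    · exact hA ⟨le_rfl, hlt.le⟩ ⟨h.le, hp.2⟩ h
end
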